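/- arXiv:2512.04818 — 8 statements merged into one kernel-verified Lean document; each statement's English description precedes it below -/
import Mathlib

section
/- Nakayama's lemma for derived complete modules: Let R be a commutative Noetherian ring and I ⊆ R an ideal. Let N and P be I-adically complete R-modules, let f : N → P be an R-linear map, and let M = P / range(f) be its cokernel (so M is derived I-complete). If I·M = M (equivalently, M/IM = 0), then M = 0. Note that no finite generation hypothesis on M is required. -/
/-- **Nakayama's lemma for derived complete modules.**
Let `R` be a commutative Noetherian ring and `I ⊆ R` an ideal. Let `N` and `P` be
`I`-adically complete `R`-modules, let `f : N → P` be an `R`-linear map, and let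
`M = P ⧸ range f` be its cokernel (so `M` is derived `I`-complete).
If `I·M = M` (equivalently, `M/IM = 0`), then `M = 0`.
No finite generation hypothesis on `M` is required. -/
theorem nakayama_derived_complete
    {R : Type*} [CommRing R] [IsNoetherianRing R] (I : Ideal R)
    {N P : Type*} [AddCommGroup N] [Module R N] [AddCommGroup P] [Module R P]
    [IsAdicComplete I N] [IsAdicComplete I P] (f : N →ₗ[R] P)
    (h : (I • ⊤ : Submodule R (P ⧸ LinearMap.range f)) = ⊤) :
    Subsingleton (P ⧸ LinearMap.range f) := by
  have hsurj : Function.Surjective f := by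
    apply surjective_of_mkQ_comp_surjective (I := I)
    intro y
    obtain ⟨p, rfl⟩ := Submodule.mkQ_surjective _ y
    have hp : (LinearMap.range f).mkQ p ∈
        Submodule.map (LinearMap.range f).mkQ (I • ⊤ : Submodule R P) := by
      rw [Submodule.map_smul'', Submodule.map_top, Submodule.range_mkQ, h]
      trivial
    obtain ⟨q, hq, hqp⟩ := hp
    have hr : p - q ∈ LinearMap.range f := by
      rw [← Submodule.Quotient.mk_eq_zero, Submodule.Quotient.mk_sub, sub_eq_zero]
      exact hqp.symm
    obtain ⟨n, hn⟩ := hr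
    refine ⟨n, ?_⟩
    have hz : (I • ⊤ : Submodule R P).mkQ q = 0 := by
      simpa using hq
    rw [LinearMap.comp_apply, hn, map_sub, hz, sub_zero]
  rw [Submodule.Quotient.subsingleton_iff]
  exact LinearMap.range_eq_top.2 hsurj
end

section
/- Let R be a commutative Noetherian ring and I ⊆ R an ideal such that R itself is I-adically complete. Let M be a derived I-complete R-module, i.e. M is the cokernel of an R-linear map between I-adically complete R-modules, and let r ∈ I. If the quotient M/rM is a finitely generated R-module, then M is a finitely generated (equivalently, since R is Noetherian, a Noetherian) R-module. -/
theorem aux_map_smul_top {R A B : Type*} [CommRing R] [AddCommGroup A] [Module R A]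
    [AddCommGroup B] [Module R B] (J : Ideal R) (L : A →ₗ[R] B) {x : A}
    (hx : x ∈ (J • ⊤ : Submodule R A)) : L x ∈ (J • ⊤ : Submodule R B) := by
  have h : L x ∈ (J • ⊤ : Submodule R A).map L := Submodule.mem_map_of_mem hx
  rw [Submodule.map_smul''] at h
  exact Submodule.smul_mono le_rfl le_top h

theorem aux_prec_prod {R A B : Type*} [CommRing R] [AddCommGroup A] [Module R A]
    [AddCommGroup B] [Module R B] (I : Ideal R) [IsPrecomplete I A] [IsPrecomplete I B] :
    IsPrecomplete I (A × B) := by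
  refine ⟨fun u hu => ?_⟩
  obtain ⟨a, ha⟩ := IsPrecomplete.prec (I := I) (M := A) inferInstance (f := fun n => (u n).1)
    (fun {m n} h => by
      have h1 := hu h
      rw [SModEq.sub_mem] at h1 ⊢
      exact aux_map_smul_top _ (LinearMap.fst R A B) h1)
  obtain ⟨b, hb⟩ := IsPrecomplete.prec (I := I) (M := B) inferInstance (f := fun n => (u n).2)
    (fun {m n} h => by
      have h1 := hu h
      rw [SModEq.sub_mem] at h1 ⊢
      exact aux_map_smul_top _ (LinearMap.snd R A B) h1)
  refine ⟨(a, b), fun n => ?_⟩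
  have h1 := ha n
  have h2 := hb n
  rw [SModEq.sub_mem] at h1 h2 ⊢
  have h3 := add_mem (aux_map_smul_top _ (LinearMap.inl R A B) h1)
    (aux_map_smul_top _ (LinearMap.inr R A B) h2)
  convert h3 using 1
  ext <;> simp

theorem aux_prec_pi {R A : Type*} [CommRing R] [AddCommGroup A] [Module R A]
    (k : ℕ) (I : Ideal R) [IsPrecomplete I A] :
    IsPrecomplete I (Fin k → A) := by
  refine ⟨fun u hu => ?_⟩
  have key : ∀ i : Fin k, ∃ L : A, ∀ n, u n i ≡ L [SMOD (I ^ n • ⊤ : Submodule R A)] := fun i =>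
    IsPrecomplete.prec (I := I) (M := A) inferInstance (f := fun n => u n i)
      (fun {m n} h => by
        have h1 := hu h
        rw [SModEq.sub_mem] at h1 ⊢
        exact aux_map_smul_top _ (LinearMap.proj (R := R) (φ := fun _ : Fin k => A) i) h1)
  choose a ha using key
  refine ⟨a, fun n => ?_⟩
  rw [SModEq.sub_mem]
  have h3 : ∑ i, LinearMap.single R (fun _ : Fin k => A) i ((u n - a) i) ∈
      (I ^ n • ⊤ : Submodule R (Fin k → A)) :=
    Submodule.sum_mem _ fun i _ => aux_map_smul_top _ _ (by
      have := ha i n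
      rwa [SModEq.sub_mem] at this)
  convert h3 using 1
  ext j
  simp

/-- Let `R` be a commutative Noetherian ring and `I ⊆ R` an ideal such that `R` itself is
`I`-adically complete. Let `M` be a derived `I`-complete `R`-module, i.e. `M` is the cokernel
`P ⧸ range f` of an `R`-linear map `f : N → P` between `I`-adically complete `R`-modules,
and let `r ∈ I`. If the quotient `M/rM` is a finitely generated `R`-module, then `M` is a
finitely generated (equivalently, since `R` is Noetherian, a Noetherian) `R`-module. -/
theorem finite_of_derived_complete_of_quotient_finite
    {R : Type*} [CommRing R] [IsNoetherianRing R] (I : Ideal R) [IsAdicComplete I R]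
    {N P : Type*} [AddCommGroup N] [Module R N] [AddCommGroup P] [Module R P]
    [IsAdicComplete I N] [IsAdicComplete I P] (f : N →ₗ[R] P)
    (r : R) (hr : r ∈ I)
    (hfg : Module.Finite R
      ((P ⧸ LinearMap.range f) ⧸
        (Ideal.span {r} • ⊤ : Submodule R (P ⧸ LinearMap.range f)))) :
    Module.Finite R (P ⧸ LinearMap.range f) := by
  set S : Submodule R (P ⧸ LinearMap.range f) := Ideal.span {r} • ⊤ with hS
  obtain ⟨k, q, hq⟩ := Module.Finite.exists_fin' R ((P ⧸ LinearMap.range f) ⧸ S)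
  have hsurj : Function.Surjective (S.mkQ ∘ₗ (LinearMap.range f).mkQ) :=
    (Submodule.mkQ_surjective _).comp (Submodule.mkQ_surjective _)
  obtain ⟨g, hg⟩ := Module.projective_lifting_property _ q hsurj
  have := aux_prec_pi (A := R) k I
  have := aux_prec_prod (A := Fin k → R) (B := N) I
  have hG : Function.Surjective (g.coprod f) := by
    apply surjective_of_mkQ_comp_surjective (I := I)
    intro y
    obtain ⟨p, rfl⟩ := Submodule.mkQ_surjective _ y
    obtain ⟨c, hc⟩ := hq (S.mkQ ((LinearMap.range f).mkQ p))
    rw [← hg] at hc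
    have h1 : (LinearMap.range f).mkQ (g c - p) ∈ S := by
      rw [map_sub]
      exact (Submodule.Quotient.eq S).1 hc
    rw [hS, Submodule.ideal_span_singleton_smul] at h1
    obtain ⟨m, -, hm⟩ := h1
    obtain ⟨p1, rfl⟩ := Submodule.mkQ_surjective _ m
    have h2 : (g c - p) - r • p1 ∈ LinearMap.range f := by
      rw [← Submodule.Quotient.mk_eq_zero, ← Submodule.mkQ_apply, map_sub, ← hm, map_smul]
      exact sub_self _
    obtain ⟨n, hn⟩ := h2
    refine ⟨(c, -n), (Submodule.Quotient.eq _).2 ?_⟩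
    have h3 : g.coprod f (c, -n) - p = r • p1 := by
      simp only [LinearMap.coprod_apply, map_neg, hn]
      abel
    rw [h3]
    exact Submodule.smul_mem_smul hr trivial
  refine Module.Finite.of_surjective ((LinearMap.range f).mkQ ∘ₗ g) ?_
  intro y
  obtain ⟨p, rfl⟩ := Submodule.mkQ_surjective _ y
  obtain ⟨⟨c, n⟩, rfl⟩ := hG p
  refine ⟨c, ?_⟩
  simp
end

section
/- Let R be a commutative ring and C an R-linear pretriangulated category with arbitrary coproducts. Let U be a thick subcategory of C and g an object of U such that: (1) every object of U lies in Locⁿ(g) for some n ∈ ℕ; and (2) for every object u of U the graded Hom ⨁_{i∈ℤ} Hom(g⟦i⟧, u) is a finitely generated R-module. Then U = thick(g). Moreover, if there exists D ∈ ℕ such that every object of U lies in Loc^D(g), then thick^D(g) = thick(g) = U; in particular g is a strong generator of U. -/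
open CategoryTheory CategoryTheory.Limits CategoryTheory.Pretriangulated DirectSum

universe v u u₁

namespace TTGStmt4

variable {C : Type u} [Category.{v} C]

/-- `z` is a direct summand (retract) of `x`. -/
def IsRetractOf (z x : C) : Prop := ∃ (i : z ⟶ x) (r : x ⟶ z), i ≫ r = 𝟙 z

section Preadditive
variable [Preadditive C]

/-- The closure of a set of objects under finite direct sums and direct summands. -/
inductive AddClosure (S : Set C) : C → Prop
  | of {x : C} (hx : x ∈ S) : AddClosure S x
  | sum {x y : C} (hx : AddClosure S x) (hy : AddClosure S y)
      (b : BinaryBicone x y) (hb : b.IsBilimit) : AddClosure S b.pt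
  | retract {x z : C} (hx : AddClosure S x) (h : IsRetractOf z x) : AddClosure S z

/-- The closure of a set of objects under arbitrary (`Type v`-indexed) coproducts and
direct summands. -/
inductive CoprodClosure (S : Set C) : C → Prop
  | of {x : C} (hx : x ∈ S) : CoprodClosure S x
  | coprod {J : Type v} (f : J → C) (hf : ∀ j, CoprodClosure S (f j))
      (cf : Cofan f) (hcf : IsColimit cf) : CoprodClosure S cf.pt
  | retract {x z : C} (hx : CoprodClosure S x) (h : IsRetractOf z x) : CoprodClosure S z

end Preadditive

section Pretriangulated
variable [HasShift C ℤ]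

/-- The set of all shifts of `g`, up to isomorphism. -/
def shiftSet (g : C) : Set C := {x | ∃ i : ℤ, Nonempty ((g⟦i⟧ : C) ≅ x)}

variable [Preadditive C] [HasZeroObject C] [∀ n : ℤ, (shiftFunctor C n).Additive]
  [Pretriangulated C]

/-- The class `S * T`: objects `t` admitting a distinguished triangle `a → t → b → a⟦1⟧`
with `a ∈ S` and `b ∈ T`. -/
def extClass (S T : Set C) : Set C :=
  {t | ∃ (a b : C) (_ : a ∈ S) (_ : b ∈ T) (f : a ⟶ t) (g : t ⟶ b) (δ : b ⟶ a⟦(1 : ℤ)⟧),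
    Triangle.mk f g δ ∈ distTriang C}

/-- Closure under direct summands. -/
def summandClosure (S : Set C) : Set C := {z | ∃ x ∈ S, IsRetractOf z x}

/-- `thickLevel g n` is `thickⁿ(g)`: `thick⁰(g)` is the closure of the shifts of `g` under
finite direct sums and direct summands; `thickⁿ⁺¹(g)` is the closure under direct summands
of the class of objects `t` admitting a distinguished triangle `a → t → b → a⟦1⟧` with
`a ∈ thick⁰(g)` and `b ∈ thickⁿ(g)`. -/
def thickLevel (g : C) : ℕ → Set C
  | 0 => AddClosure (shiftSet g)
  | (n + 1) => summandClosure (extClass (thickLevel g 0) (thickLevel g n))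

/-- `locLevel g n` is `Locⁿ(g)`, defined as `thickⁿ(g)` but allowing arbitrary coproducts
in the closure operations. -/
def locLevel (g : C) : ℕ → Set C
  | 0 => CoprodClosure (shiftSet g)
  | (n + 1) => setOf (CoprodClosure (extClass (locLevel g 0) (locLevel g n)))

/-- A thick subcategory of a pretriangulated category: a (strictly full) triangulated
subcategory closed under direct summands, encoded via its class of objects. -/
structure IsThickSubcat (U : Set C) : Prop where
  shift : ∀ {x : C} (n : ℤ), x ∈ U → (x⟦n⟧ : C) ∈ U
  ext₂ : ∀ T : Triangle C, (T ∈ distTriang C) → T.obj₁ ∈ U → T.obj₃ ∈ U → T.obj₂ ∈ U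
  retract : ∀ {x z : C}, x ∈ U → IsRetractOf z x → z ∈ U

end Pretriangulated

section Helpers
variable [Preadditive C]

/-- `f` kills all maps from objects of `CoprodClosure S` as soon as it kills maps from `S`. -/
lemma coprodClosure_kill (S : Set C) {w y : C} (f : w ⟶ y)
    (hS : ∀ x ∈ S, ∀ h : x ⟶ w, h ≫ f = 0) {x : C} (hx : CoprodClosure S x) :
    ∀ h : x ⟶ w, h ≫ f = 0 := by
  induction hx with
  | of hx => exact hS _ hx
  | coprod F _ cf hcf ih =>
    intro h
    refine Cofan.IsColimit.hom_ext hcf _ _ fun j => ?_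
    rw [← Category.assoc, ih j, comp_zero]
  | retract _ hr ih =>
    intro h
    obtain ⟨i, r, hir⟩ := hr
    calc h ≫ f = i ≫ ((r ≫ h) ≫ f) := by
          rw [Category.assoc, ← Category.assoc i, hir, Category.id_comp]
      _ = 0 := by rw [ih, comp_zero]

variable [HasZeroObject C] [HasShift C ℤ] [∀ n : ℤ, (shiftFunctor C n).Additive]
  [Pretriangulated C]

/-- The elements of the graded Hom all of whose components factor through `p`. -/
def factSub (R : Type u₁) [CommRing R] [CategoryTheory.Linear R C] (g : C) {G w : C}
    (p : G ⟶ w) : Submodule R (⨁ i : ℤ, ((g⟦i⟧ : C) ⟶ w)) where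
  carrier := {x | ∀ i, ∃ q : (g⟦i⟧ : C) ⟶ G, q ≫ p = x i}
  add_mem' := by
    intro a b ha hb i
    obtain ⟨q, hq⟩ := ha i
    obtain ⟨q', hq'⟩ := hb i
    exact ⟨q + q', by rw [Preadditive.add_comp, hq, hq', DirectSum.add_apply]⟩
  zero_mem' := fun i => ⟨0, by rw [zero_comp, DirectSum.zero_apply]⟩
  smul_mem' := by
    intro r a ha i
    obtain ⟨q, hq⟩ := ha i
    exact ⟨r • q, by rw [Linear.smul_comp, hq, DirectSum.smul_apply]⟩

lemma factSub_mono (R : Type u₁) [CommRing R] [CategoryTheory.Linear R C] (g : C) {G G' w : C}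
    (p : G ⟶ w) (p' : G' ⟶ w) (e : G ⟶ G') (he : e ≫ p' = p) :
    factSub R g p ≤ factSub R g p' := by
  intro x hx i
  obtain ⟨q, hq⟩ := hx i
  exact ⟨q ≫ e, by rw [Category.assoc, he, hq]⟩

lemma exists_join (R : Type u₁) [CommRing R] [CategoryTheory.Linear R C] (g : C) {G G' w : C}
    (hG : AddClosure (shiftSet g) G) (hG' : AddClosure (shiftSet g) G')
    (p : G ⟶ w) (p' : G' ⟶ w) :
    ∃ (H : C) (_ : AddClosure (shiftSet g) H) (q : H ⟶ w),
      factSub R g p ≤ factSub R g q ∧ factSub R g p' ≤ factSub R g q := by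
  refine ⟨_, AddClosure.sum hG hG' (BinaryBiproduct.bicone G G')
    (BinaryBiproduct.isBilimit G G'), biprod.desc p p', ?_, ?_⟩
  · exact factSub_mono R g _ _ biprod.inl (biprod.inl_desc _ _)
  · exact factSub_mono R g _ _ biprod.inr (biprod.inr_desc _ _)

lemma mem_thick_zero (g x : C) : x ∈ thickLevel g 0 ↔ AddClosure (shiftSet g) x := by
  rw [thickLevel]; rfl

lemma mem_thick_succ (g x : C) (n : ℕ) : x ∈ thickLevel g (n + 1) ↔
    ∃ y ∈ extClass (thickLevel g 0) (thickLevel g n), IsRetractOf x y := by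
  rw [thickLevel.eq_2]; rfl

lemma mem_loc_zero (g x : C) : x ∈ locLevel g 0 ↔ CoprodClosure (shiftSet g) x := by
  rw [locLevel]; rfl

lemma mem_loc_succ (g x : C) (n : ℕ) : x ∈ locLevel g (n + 1) ↔
    CoprodClosure (extClass (locLevel g 0) (locLevel g n)) x := by
  rw [locLevel.eq_2]; rfl

lemma g_mem (g : C) (i : ℤ) : AddClosure (shiftSet g) (g⟦i⟧ : C) :=
  AddClosure.of ⟨i, ⟨Iso.refl _⟩⟩

lemma exists_single (R : Type u₁) [CommRing R] [CategoryTheory.Linear R C] (g : C) {w : C}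
    (x : ⨁ i : ℤ, ((g⟦i⟧ : C) ⟶ w)) :
    ∃ (H : C) (_ : AddClosure (shiftSet g) H) (q : H ⟶ w), x ∈ factSub R g q := by
  classical
  induction x using DirectSum.induction_on with
  | zero => exact ⟨_, g_mem g 0, 0, Submodule.zero_mem _⟩
  | of i f =>
    refine ⟨_, g_mem g i, f, fun j => ?_⟩
    by_cases h : i = j
    · subst h
      exact ⟨𝟙 _, by rw [Category.id_comp, DirectSum.of_eq_same]⟩
    · exact ⟨0, by rw [zero_comp, DirectSum.of_eq_of_ne _ _ _ (Ne.symm h)]⟩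
  | add a b ha hb =>
    obtain ⟨G, hG, p, hp⟩ := ha
    obtain ⟨G', hG', p', hp'⟩ := hb
    obtain ⟨H, hH, q, h1, h2⟩ := exists_join R g hG hG' p p'
    exact ⟨H, hH, q, Submodule.add_mem _ (h1 hp) (h2 hp')⟩

lemma exists_approx (R : Type u₁) [CommRing R] [CategoryTheory.Linear R C] (g w : C)
    (h : Module.Finite R (⨁ i : ℤ, ((g⟦i⟧ : C) ⟶ w))) :
    ∃ (G : C) (_ : AddClosure (shiftSet g) G) (p : G ⟶ w),
      ∀ (i : ℤ) (f : (g⟦i⟧ : C) ⟶ w), ∃ q, q ≫ p = f := by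
  classical
  have key : ∀ N : Submodule R (⨁ i : ℤ, ((g⟦i⟧ : C) ⟶ w)), N.FG →
      ∃ (G : C) (_ : AddClosure (shiftSet g) G) (p : G ⟶ w), N ≤ factSub R g p := by
    intro N hN
    refine Submodule.fg_induction (motive := fun N _ => ∃ (G : C) (_ : AddClosure (shiftSet g) G)
      (p : G ⟶ w), N ≤ factSub R g p) ?_ ?_ N hN
    · intro x
      obtain ⟨H, hH, q, hq⟩ := exists_single R g x
      exact ⟨H, hH, q, by rwa [Submodule.span_singleton_le_iff_mem]⟩
    · rintro N₁ N₂ - - ⟨G, hG, p, hp⟩ ⟨G', hG', p', hp'⟩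
      obtain ⟨H, hH, q, h1, h2⟩ := exists_join R g hG hG' p p'
      exact ⟨H, hH, q, sup_le (hp.trans h1) (hp'.trans h2)⟩
  obtain ⟨G, hG, p, hp⟩ := key ⊤ h.fg_top
  refine ⟨G, hG, p, fun i f => ?_⟩
  obtain ⟨q, hq⟩ := hp (x := DirectSum.of (fun i : ℤ => ((g⟦i⟧ : C) ⟶ w)) i f) trivial i
  exact ⟨q, by rw [hq, DirectSum.of_eq_same]⟩

lemma addClosure_sub {U : Set C} (hU : IsThickSubcat U) {g : C} (hg : g ∈ U) {x : C}
    (hx : AddClosure (shiftSet g) x) : x ∈ U := by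
  induction hx with
  | of hx =>
    obtain ⟨i, ⟨e⟩⟩ := hx
    exact hU.retract (hU.shift i hg) ⟨e.inv, e.hom, e.inv_hom_id⟩
  | @sum x y _ _ b hb ihx ihy =>
    have h : (x ⊞ y) ∈ U := hU.ext₂ _ (binaryBiproductTriangle_distinguished x y) ihx ihy
    refine hU.retract h ⟨b.fst ≫ biprod.inl + b.snd ≫ biprod.inr,
      biprod.desc b.inl b.inr, ?_⟩
    simp [Preadditive.add_comp, IsBilimit.binary_total hb]
  | retract _ hr ih => exact hU.retract ih hr

lemma thickLevel_sub {U : Set C} (hU : IsThickSubcat U) {g : C} (hg : g ∈ U) (n : ℕ) :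
    thickLevel g n ⊆ U := by
  induction n with
  | zero => exact fun x hx => addClosure_sub hU hg ((mem_thick_zero g x).1 hx)
  | succ n ih =>
    intro z hz
    obtain ⟨x, ⟨a, b, ha, hb, f, k, δ, hT⟩, hr⟩ := (mem_thick_succ g z n).1 hz
    exact hU.retract (hU.ext₂ _ hT (addClosure_sub hU hg ((mem_thick_zero g a).1 ha)) (ih hb)) hr

lemma main_induction (R : Type u₁) [CommRing R] [CategoryTheory.Linear R C]
    {U : Set C} (hU : IsThickSubcat U) {g : C} (hg : g ∈ U)
    (h2 : ∀ u ∈ U, Module.Finite R (⨁ i : ℤ, ((g⟦i⟧ : C) ⟶ u))) (n : ℕ) :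
    ∀ w ∈ U, ∃ (y : C) (φ : w ⟶ y) (F : C) (p : F ⟶ w), F ∈ thickLevel g n ∧
      (∀ (x : C) (k : x ⟶ w), k ≫ φ = 0 → ∃ s : x ⟶ F, s ≫ p = k) ∧
      (∀ b ∈ locLevel g n, ∀ h : b ⟶ w, h ≫ φ = 0) := by
  have step : ∀ w ∈ U, ∃ (G w₁ : C) (p : G ⟶ w) (f : w ⟶ w₁) (δ : w₁ ⟶ G⟦(1 : ℤ)⟧),
      AddClosure (shiftSet g) G ∧ w₁ ∈ U ∧ (Triangle.mk p f δ ∈ distTriang C) ∧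
      (∀ b ∈ locLevel g 0, ∀ h : b ⟶ w, h ≫ f = 0) := by
    intro w hw
    obtain ⟨G, hG, p, hp⟩ := exists_approx R g w (h2 w hw)
    obtain ⟨w₁, f, δ, hT⟩ := distinguished_cocone_triangle p
    refine ⟨G, w₁, p, f, δ, hG, ?_, hT, ?_⟩
    · exact hU.ext₂ _ (rot_of_distTriang _ hT) hw (hU.shift 1 (addClosure_sub hU hg hG))
    · intro b hb
      refine coprodClosure_kill (shiftSet g) f ?_ ((mem_loc_zero g b).1 hb)
      rintro x ⟨i, ⟨e⟩⟩ h
      obtain ⟨q, hq⟩ := hp i (e.hom ≫ h)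
      have hz : p ≫ f = 0 := comp_distTriang_mor_zero₁₂ _ hT
      rw [← cancel_epi e.hom, ← Category.assoc, ← hq, Category.assoc, hz, comp_zero, comp_zero]
  induction n with
  | zero =>
    intro w hw
    obtain ⟨G, w₁, p, f, δ, hG, -, hT, hk⟩ := step w hw
    refine ⟨w₁, f, G, p, (mem_thick_zero g G).2 hG, fun x k hkf => ?_, hk⟩
    obtain ⟨s, hs⟩ := Triangle.coyoneda_exact₂ _ hT k hkf
    exact ⟨s, hs.symm⟩
  | succ n ih =>
    intro w hw
    obtain ⟨G, w₁, p, f, δ, hG, hw₁, hT, hk⟩ := step w hw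
    obtain ⟨y, φ, F, ι, hF, hfac, hkill⟩ := ih w₁ hw₁
    obtain ⟨t, a, c, hT'⟩ := distinguished_cocone_triangle₂ (ι ≫ δ)
    obtain ⟨b, hb₁, hb₂⟩ : ∃ b : t ⟶ w, a ≫ b = 𝟙 G ≫ p ∧ c ≫ ι = b ≫ f := complete_distinguished_triangle_morphism₂ _ _ hT' hT (𝟙 G) ι
      (by
        change (ι ≫ δ) ≫ (shiftFunctor C (1 : ℤ)).map (𝟙 G) = ι ≫ δ
        rw [CategoryTheory.Functor.map_id, Category.comp_id])
    replace hb₁ : a ≫ b = p := hb₁.trans (Category.id_comp p)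
    replace hb₂ : c ≫ ι = b ≫ f := hb₂
    refine ⟨y, f ≫ φ, t, b, ?_, ?_, ?_⟩
    · exact (mem_thick_succ g t n).2 ⟨t, ⟨G, F, (mem_thick_zero g G).2 hG, hF, a, c, ι ≫ δ, hT'⟩, 𝟙 t, 𝟙 t, Category.id_comp _⟩
    · intro x k hk0
      obtain ⟨s, hs⟩ := hfac x (k ≫ f) (by rw [Category.assoc, hk0])
      have hz : f ≫ δ = 0 := comp_distTriang_mor_zero₂₃ _ hT
      obtain ⟨l, hl⟩ : ∃ l : x ⟶ t, s = l ≫ c := Triangle.coyoneda_exact₃ _ hT' s (by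
        change s ≫ ι ≫ δ = 0
        rw [← Category.assoc, hs, Category.assoc, hz, comp_zero])
      obtain ⟨m, hm⟩ : ∃ m : x ⟶ G, k - l ≫ b = m ≫ p := Triangle.coyoneda_exact₂ _ hT (k - l ≫ b) (by
        change (k - l ≫ b) ≫ f = 0
        rw [Preadditive.sub_comp, Category.assoc, ← hb₂, ← Category.assoc, ← hl, hs, sub_self])
      refine ⟨l + m ≫ a, ?_⟩
      rw [Preadditive.add_comp, Category.assoc, hb₁, ← hm]
      abel
    · intro d hd
      refine coprodClosure_kill _ (f ≫ φ) ?_ ((mem_loc_succ g d n).1 hd)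
      rintro x ⟨a', b', ha', hb', f', k', δ', hT''⟩ h
      obtain ⟨l, hl⟩ : ∃ l : b' ⟶ w₁, h ≫ f = k' ≫ l := Triangle.yoneda_exact₂ _ hT'' (h ≫ f) (by
        change f' ≫ h ≫ f = 0
        rw [← Category.assoc]
        exact hk a' ha' _)
      rw [← Category.assoc, hl, Category.assoc, hkill b' hb', comp_zero]

lemma loc_sub_thick (R : Type u₁) [CommRing R] [CategoryTheory.Linear R C]
    {U : Set C} (hU : IsThickSubcat U) {g : C} (hg : g ∈ U)
    (h2 : ∀ u ∈ U, Module.Finite R (⨁ i : ℤ, ((g⟦i⟧ : C) ⟶ u))) (n : ℕ) {u : C}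
    (hu : u ∈ U) (hn : u ∈ locLevel g n) : u ∈ thickLevel g n := by
  obtain ⟨y, φ, F, p, hF, hfac, hkill⟩ := main_induction R hU hg h2 n u hu
  obtain ⟨s, hs⟩ := hfac u (𝟙 u) (hkill u hn _)
  cases n with
  | zero => exact (mem_thick_zero g u).2 (AddClosure.retract ((mem_thick_zero g F).1 hF) ⟨s, p, hs⟩)
  | succ n =>
    obtain ⟨x, hx, i, r, hir⟩ := (mem_thick_succ g F n).1 hF
    refine (mem_thick_succ g u n).2 ⟨x, hx, s ≫ i, r ≫ p, ?_⟩
    rw [Category.assoc, ← Category.assoc i, hir, Category.id_comp, hs]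

end Helpers

/-- Let `C` be an `R`-linear pretriangulated category with arbitrary coproducts, `U` a thick
subcategory of `C` and `g` an object of `U` such that (1) every object of `U` lies in
`Locⁿ(g)` for some `n ∈ ℕ`, and (2) for every object `u` of `U` the graded Hom
`⨁_{i∈ℤ} Hom(g⟦i⟧, u)` is a finitely generated `R`-module. Then `U = thick(g)`.
Moreover, if there is `D ∈ ℕ` such that every object of `U` lies in `Loc^D(g)`, then
`thick^D(g) = thick(g) = U`; in particular `g` is a strong generator of `U`. -/
theorem thick_eq_of_loc_of_finite
    (R : Type u₁) [CommRing R]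
    {C : Type u} [Category.{v} C] [Preadditive C] [CategoryTheory.Linear R C]
    [HasZeroObject C] [HasShift C ℤ] [∀ n : ℤ, (shiftFunctor C n).Additive]
    [Pretriangulated C] [HasCoproducts.{v} C]
    (U : Set C) (hU : IsThickSubcat U) (g : C) (hg : g ∈ U)
    (h1 : ∀ u ∈ U, ∃ n : ℕ, u ∈ locLevel g n)
    (h2 : ∀ u ∈ U, Module.Finite R (⨁ i : ℤ, ((g⟦i⟧ : C) ⟶ u))) :
    U = (⋃ n : ℕ, thickLevel g n) ∧
      ∀ D : ℕ, (∀ u ∈ U, u ∈ locLevel g D) →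
        thickLevel g D = (⋃ n : ℕ, thickLevel g n) ∧ thickLevel g D = U := by
  have hsub : (⋃ n : ℕ, thickLevel g n) ⊆ U :=
    Set.iUnion_subset fun n => thickLevel_sub hU hg n
  refine ⟨Set.Subset.antisymm (fun x hx => ?_) hsub, fun D hD => ?_⟩
  · obtain ⟨n, hn⟩ := h1 x hx
    exact Set.mem_iUnion.2 ⟨n, loc_sub_thick R hU hg h2 n hx hn⟩
  · have hDU : U ⊆ thickLevel g D := fun x hx => loc_sub_thick R hU hg h2 D hx (hD x hx)
    exact ⟨Set.Subset.antisymm (Set.subset_iUnion _ D) (hsub.trans hDU),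
      Set.Subset.antisymm (thickLevel_sub hU hg D) hDU⟩


end TTGStmt4
end

section
/- Let R be a commutative Noetherian ring and C an R-linear pretriangulated category with arbitrary coproducts. Assume: (1) for all compact objects c, c' of C the graded Hom ⨁_{i∈ℤ} Hom(c⟦i⟧, c') is a finitely generated R-module; (2) there is a compact object g and D ∈ ℕ such that every compact object of C lies in thick^D(g); and (3) g generates C, i.e. any object x with Hom(g⟦n⟧, x) = 0 for all n ∈ ℤ is zero. Then every object x of C such that ⨁_{i∈ℤ} Hom(c⟦i⟧, x) is a finitely generated R-module for every compact object c is itself compact; in fact, every such x lies in thick^{2D+1}(g). (In the paper's terminology: a compactly generated Noetherian R-linear category whose compacts admit a strong generator is strictly Noetherian.) -/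
open CategoryTheory CategoryTheory.Limits CategoryTheory.Pretriangulated DirectSum

universe v u u₁

namespace TTGStmt5

variable {C : Type u} [Category.{v} C]

/-- `z` is a direct summand (retract) of `x`. -/
def IsRetractOf (z x : C) : Prop := ∃ (i : z ⟶ x) (r : x ⟶ z), i ≫ r = 𝟙 z

section Preadditive
variable [Preadditive C]

/-- The closure of a set of objects under finite direct sums and direct summands. -/
inductive AddClosure (S : Set C) : C → Prop
  | of {x : C} (hx : x ∈ S) : AddClosure S x
  | sum {x y : C} (hx : AddClosure S x) (hy : AddClosure S y)
      (b : BinaryBicone x y) (hb : b.IsBilimit) : AddClosure S b.pt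
  | retract {x z : C} (hx : AddClosure S x) (h : IsRetractOf z x) : AddClosure S z

variable [HasCoproducts.{v} C]

/-- An object `c` is compact if for every family `(f j)` of objects the canonical map
`⨁_j Hom(c, f j) → Hom(c, ∐_j f j)` is bijective. -/
def IsCompactObj (c : C) : Prop :=
  ∀ (J : Type v) [DecidableEq J] (f : J → C),
    Function.Bijective (DirectSum.toAddMonoid
      (fun j : J => AddMonoidHom.mk' (fun φ : c ⟶ f j => φ ≫ Sigma.ι f j)
        (fun a b => Preadditive.add_comp _ _ _ a b _)) :
      (⨁ j : J, (c ⟶ f j)) →+ (c ⟶ ∐ f))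

end Preadditive

section Pretriangulated
variable [HasShift C ℤ]

/-- The set of all shifts of `g`, up to isomorphism. -/
def shiftSet (g : C) : Set C := {x | ∃ i : ℤ, Nonempty ((g⟦i⟧ : C) ≅ x)}

variable [Preadditive C] [HasZeroObject C] [∀ n : ℤ, (shiftFunctor C n).Additive]
  [Pretriangulated C]

/-- The class `S * T`: objects `t` admitting a distinguished triangle `a → t → b → a⟦1⟧`
with `a ∈ S` and `b ∈ T`. -/
def extClass (S T : Set C) : Set C :=
  {t | ∃ (a b : C) (_ : a ∈ S) (_ : b ∈ T) (f : a ⟶ t) (g : t ⟶ b) (δ : b ⟶ a⟦(1 : ℤ)⟧),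
    Triangle.mk f g δ ∈ distTriang C}

/-- Closure under direct summands. -/
def summandClosure (S : Set C) : Set C := {z | ∃ x ∈ S, IsRetractOf z x}

/-- `thickLevel g n` is `thickⁿ(g)`. -/
def thickLevel (g : C) : ℕ → Set C
  | 0 => AddClosure (shiftSet g)
  | (n + 1) => summandClosure (extClass (thickLevel g 0) (thickLevel g n))

end Pretriangulated

section Helpers

open Classical in
/-- truncation of a coproduct to a finite set of summands -/
noncomputable def tr [Preadditive C] [HasCoproducts.{v} C] {J : Type v} (f : J → C)
    (s : Finset J) : ∐ f ⟶ ∐ f :=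
  Sigma.desc (fun j => if j ∈ s then Sigma.ι f j else 0)

section A
variable [Preadditive C] [HasCoproducts.{v} C]

open Classical in
lemma ι_tr {J : Type v} (f : J → C) (s : Finset J) (j : J) :
    Sigma.ι f j ≫ tr f s = if j ∈ s then Sigma.ι f j else 0 := by
  simp [tr]

lemma tr_tr {J : Type v} (f : J → C) {s s' : Finset J} (h : s ⊆ s') :
    tr f s ≫ tr f s' = tr f s := by
  classical
  refine Sigma.hom_ext _ _ (fun j => ?_)
  rw [← Category.assoc, ι_tr]
  split_ifs with hj
  · rw [ι_tr, if_pos (h hj)]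
  · simp

lemma tr_eq_sum {J : Type v} [DecidableEq J] (f : J → C) (s : Finset J) :
    tr f s = ∑ j ∈ s, Sigma.π f j ≫ Sigma.ι f j := by
  refine Sigma.hom_ext _ _ (fun j => ?_)
  rw [ι_tr, Preadditive.comp_sum]
  have : ∀ k ∈ s, Sigma.ι f j ≫ Sigma.π f k ≫ Sigma.ι f k =
      if j = k then Sigma.ι f j else 0 := by
    intro k _
    split_ifs with h
    · subst h; simp
    · rw [← Category.assoc, Sigma.ι_π_of_ne _ h, zero_comp]
  rw [Finset.sum_congr rfl this]
  simp

/-- a map to a coproduct landing in a finite subsum -/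
def FinMap {J : Type v} {f : J → C} {c : C} (h : c ⟶ ∐ f) : Prop := ∃ s, h ≫ tr f s = h

lemma FinMap.add {J : Type v} {f : J → C} {c : C} {h h' : c ⟶ ∐ f}
    (H : FinMap h) (H' : FinMap h') : FinMap (h + h') := by
  classical
  obtain ⟨s, hs⟩ := H
  obtain ⟨s', hs'⟩ := H'
  refine ⟨s ∪ s', ?_⟩
  rw [Preadditive.add_comp, ← hs, ← hs', Category.assoc, Category.assoc,
    tr_tr f Finset.subset_union_left, tr_tr f Finset.subset_union_right]

lemma FinMap.precomp {J : Type v} {f : J → C} {c d : C} {h : c ⟶ ∐ f}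
    (H : FinMap h) (p : d ⟶ c) : FinMap (p ≫ h) := by
  obtain ⟨s, hs⟩ := H
  exact ⟨s, by rw [Category.assoc, hs]⟩

lemma FinMap.tr {J : Type v} {f : J → C} {c : C} (h : c ⟶ ∐ f) (s : Finset J) :
    FinMap (h ≫ tr f s) := ⟨s, by rw [Category.assoc, tr_tr f subset_rfl]⟩

lemma isCompactObj_iff (c : C) :
    IsCompactObj c ↔ ∀ (J : Type v) (f : J → C) (h : c ⟶ ∐ f), FinMap h := by
  classical
  constructor
  · intro H J f h
    obtain ⟨d, rfl⟩ := (H J f).2 h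
    induction d using DirectSum.induction_on with
    | zero => exact ⟨∅, by simp⟩
    | of i x =>
      refine ⟨{i}, ?_⟩
      rw [DirectSum.toAddMonoid_of]
      simp [ι_tr]
    | add x y hx hy => rw [map_add]; exact hx.add hy
  · intro H J _ f
    constructor
    · rw [injective_iff_map_eq_zero]
      intro d hd
      ext j
      have key : ∀ d : (⨁ j : J, (c ⟶ f j)), (DirectSum.toAddMonoid
        (fun j : J => AddMonoidHom.mk' (fun φ : c ⟶ f j => φ ≫ Sigma.ι f j)
        (fun a b => Preadditive.add_comp _ _ _ a b _)) d) ≫ Sigma.π f j = d j := by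
        intro d
        induction d using DirectSum.induction_on with
        | zero => simp
        | of i x =>
          rw [DirectSum.toAddMonoid_of]
          by_cases hij : i = j
          · subst hij; simp
          · simp [Sigma.ι_π_of_ne _ hij, DirectSum.of_eq_of_ne _ _ _ (Ne.symm hij)]
        | add x y hx hy => rw [map_add, Preadditive.add_comp, hx, hy, DirectSum.add_apply]
      rw [← key d, hd]; simp
    · intro h
      obtain ⟨s, hs⟩ := H J f h
      refine ⟨∑ j ∈ s, DirectSum.of (fun j => (c ⟶ f j)) j (h ≫ Sigma.π f j), ?_⟩
      rw [map_sum]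
      conv_rhs => rw [← hs, tr_eq_sum, Preadditive.comp_sum]
      refine Finset.sum_congr rfl (fun j _ => ?_)
      rw [DirectSum.toAddMonoid_of]
      simp

lemma compact_of_retract_iso {c d : C} (hc : IsCompactObj c) (i : d ⟶ c) (r : c ⟶ d)
    (h : i ≫ r = 𝟙 d) : IsCompactObj d := by
  rw [isCompactObj_iff] at *
  intro J f k
  have := (hc J f (r ≫ k)).precomp i
  rwa [← Category.assoc, h, Category.id_comp] at this

lemma compact_biprod [HasBinaryBiproducts C] {c d : C} (hc : IsCompactObj c)
    (hd : IsCompactObj d) : IsCompactObj (c ⊞ d) := by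
  rw [isCompactObj_iff] at *
  intro J f k
  have := ((hc J f (biprod.inl ≫ k)).precomp biprod.fst).add
    ((hd J f (biprod.inr ≫ k)).precomp biprod.snd)
  rwa [← Category.assoc, ← Category.assoc, ← Preadditive.add_comp, biprod.total,
    Category.id_comp] at this

variable [HasShift C ℤ] [∀ n : ℤ, (shiftFunctor C n).Additive]

lemma compact_shift {c : C} (hc : IsCompactObj c) (n : ℤ) : IsCompactObj (c⟦n⟧ : C) := by
  classical
  rw [isCompactObj_iff] at *
  intro J f h
  let G := shiftFunctor C (-n)
  let θ := sigmaComparison G f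
  let e : (c⟦n⟧ : C)⟦-n⟧ ≅ c := (shiftShiftNeg c n)
  obtain ⟨s, hs⟩ := hc J (fun j => G.obj (f j)) (e.inv ≫ G.map h ≫ inv θ)
  refine ⟨s, G.map_injective ?_⟩
  have h1 : tr (fun j => G.obj (f j)) s ≫ θ = θ ≫ G.map (tr f s) := by
    refine Sigma.hom_ext _ _ (fun j => ?_)
    rw [← Category.assoc, ι_tr, ← Category.assoc, ι_comp_sigmaComparison, ← G.map_comp, ι_tr]
    split_ifs
    · rw [ι_comp_sigmaComparison]
    · simp
  have h2 : inv θ ≫ tr (fun j => G.obj (f j)) s = G.map (tr f s) ≫ inv θ := by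
    rw [IsIso.inv_comp_eq, ← Category.assoc, ← h1]; simp
  simp only [Category.assoc, h2] at hs
  rw [cancel_epi, ← Category.assoc, cancel_mono] at hs
  rw [G.map_comp, hs]

variable [HasZeroObject C] [Pretriangulated C]

lemma tri_step {a t b : C} (p : a ⟶ t) (q : t ⟶ b) (δ : b ⟶ a⟦(1 : ℤ)⟧)
    (hT : Triangle.mk p q δ ∈ distTriang C) (ha : IsCompactObj a)
    {J : Type v} (f : J → C) (h : t ⟶ ∐ f) :
    ∃ h' : b ⟶ ∐ f, FinMap (h - q ≫ h') := by
  obtain ⟨s, hs⟩ := (isCompactObj_iff a).1 ha J f (p ≫ h)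
  obtain ⟨h', hh'⟩ := Triangle.yoneda_exact₂ _ hT (h - h ≫ tr f s) (by
    change p ≫ _ = 0
    rw [Preadditive.comp_sub, ← Category.assoc, hs, sub_self])
  refine ⟨h', ?_⟩
  change _ = q ≫ h' at hh'
  rw [← hh', sub_sub_cancel]
  exact FinMap.tr h s

lemma compact_ext {a t b : C} (p : a ⟶ t) (q : t ⟶ b) (δ : b ⟶ a⟦(1 : ℤ)⟧)
    (hT : Triangle.mk p q δ ∈ distTriang C) (ha : IsCompactObj a) (hb : IsCompactObj b) :
    IsCompactObj t := by
  rw [isCompactObj_iff t]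
  intro J f h
  obtain ⟨h', H⟩ := tri_step p q δ hT ha f h
  have := H.add (((isCompactObj_iff b).1 hb J f h').precomp q)
  rwa [sub_add_cancel] at this

lemma compact_cone {a t b : C} (p : a ⟶ t) (q : t ⟶ b) (δ : b ⟶ a⟦(1 : ℤ)⟧)
    (hT : Triangle.mk p q δ ∈ distTriang C) (ha : IsCompactObj a) (ht : IsCompactObj t) :
    IsCompactObj b :=
  compact_ext _ _ _ (rot_of_distTriang _ hT) ht (compact_shift ha 1)

/-- `w` kills all maps from `thickLevel g n` -/
def Gh (g : C) (n : ℕ) {y z : C} (w : y ⟶ z) : Prop :=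
  ∀ c ∈ thickLevel g n, ∀ v : c ⟶ y, v ≫ w = 0

lemma gh_zero {g : C} {y z : C} (w : y ⟶ z)
    (H : ∀ (i : ℤ) (v : (g⟦i⟧ : C) ⟶ y), v ≫ w = 0) : Gh g 0 w := by
  intro c hc
  rw [thickLevel] at hc
  change AddClosure (shiftSet g) c at hc
  induction hc with
  | of hx =>
    obtain ⟨i, ⟨e⟩⟩ := hx
    intro v
    rw [← cancel_epi e.hom, ← Category.assoc, H, comp_zero]
  | sum hx hy b hb ihx ihy =>
    intro v
    refine BinaryCofan.IsColimit.hom_ext hb.isColimit ?_ ?_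
    · change b.inl ≫ v ≫ w = b.inl ≫ 0
      rw [← Category.assoc, ihx, comp_zero]
    · change b.inr ≫ v ≫ w = b.inr ≫ 0
      rw [← Category.assoc, ihy, comp_zero]
  | retract hx h ih =>
    intro v
    obtain ⟨i, r, hir⟩ := h
    have := ih (r ≫ v)
    rw [← Category.id_comp v, ← hir, Category.assoc, Category.assoc, ← Category.assoc r, this,
      comp_zero]

lemma gh_succ {g : C} {n : ℕ} {y z z' : C} (w : y ⟶ z) (w' : z ⟶ z') (H : Gh g 0 w)
    (H' : Gh g n w') : Gh g (n + 1) (w ≫ w') := by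
  intro c hc v
  rw [thickLevel] at hc
  obtain ⟨t, ⟨a, b, ha, hb, p, q, δ, hT⟩, i, r, hir⟩ := hc
  have h0 : p ≫ r ≫ v ≫ w = 0 := by
    have := H a ha (p ≫ r ≫ v)
    simpa using this
  obtain ⟨k, hk⟩ : ∃ k : b ⟶ z, r ≫ v ≫ w = q ≫ k :=
    Triangle.yoneda_exact₂ _ hT (r ≫ v ≫ w) h0
  have h2 : r ≫ v ≫ w ≫ w' = 0 := by
    have := congrArg (· ≫ w') hk
    simp only [Category.assoc] at this
    rw [this, H' b hb, comp_zero]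
  rw [← Category.id_comp v, ← hir]
  simp [h2]

lemma thick_succ {g c : C} {n : ℕ} (hc : c ∈ thickLevel g n) : c ∈ thickLevel g (n + 1) := by
  rw [thickLevel]
  refine ⟨c, ⟨_, c, ?_, hc, _, _, _, contractible_distinguished₁ c⟩, 𝟙 c, 𝟙 c, by simp⟩
  rw [thickLevel]
  exact AddClosure.retract (AddClosure.of ⟨0, ⟨Iso.refl _⟩⟩) ⟨0, 0, (isZero_zero C).eq_of_src _ _⟩

lemma thick_le {g c : C} {n m : ℕ} (h : n ≤ m) (hc : c ∈ thickLevel g n) :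
    c ∈ thickLevel g m := by
  induction h with
  | refl => exact hc
  | step _ ih => exact thick_succ ih

end A

section B
variable (R : Type u₁) [CommRing R] [IsNoetherianRing R] [Preadditive C]
  [CategoryTheory.Linear R C]
    [HasZeroObject C] [HasShift C ℤ] [∀ n : ℤ, (shiftFunctor C n).Additive]
    [Pretriangulated C] [HasCoproducts.{v} C]

/-- graded Hom from `g` is finite -/
def FinHom (g y : C) : Prop := Module.Finite R (⨁ i : ℤ, ((g⟦i⟧ : C) ⟶ y))

lemma finHom_ext {g a t b : C} (p : a ⟶ t) (q : t ⟶ b) (δ : b ⟶ a⟦(1 : ℤ)⟧)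
    (hT : Triangle.mk p q δ ∈ distTriang C) (ha : FinHom R g a) (hb : FinHom R g b) :
    FinHom R g t := by
  have : Module.Finite R (⨁ i : ℤ, ((g⟦i⟧ : C) ⟶ a)) := ha
  have : Module.Finite R (⨁ i : ℤ, ((g⟦i⟧ : C) ⟶ b)) := hb
  have := isNoetherian_of_range_eq_ker
    (DirectSum.lmap (fun i : ℤ => Linear.rightComp R (g⟦i⟧ : C) p))
    (DirectSum.lmap (fun i : ℤ => Linear.rightComp R (g⟦i⟧ : C) q)) (by
      rw [DirectSum.ker_lmap, DirectSum.range_lmap]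
      congr 2
      funext i
      ext u
      constructor
      · rintro ⟨k, rfl⟩
        have : p ≫ q = 0 := comp_distTriang_mor_zero₁₂ _ hT
        simp [this]
      · intro hu
        obtain ⟨k, hk⟩ := Triangle.coyoneda_exact₂ _ hT u hu
        exact ⟨k, hk.symm⟩)
  unfold FinHom
  infer_instance

lemma exists_cover {g : C} (hg : IsCompactObj g) (y z : C) (w : y ⟶ z)
    (S : Finset (Σ i : ℤ, ((g⟦i⟧ : C) ⟶ y))) (hS : ∀ k ∈ S, k.2 ≫ w = 0) :
    ∃ (P : C) (_ : IsCompactObj P) (p : P ⟶ y), p ≫ w = 0 ∧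
      ∀ k ∈ S, ∃ v, v ≫ p = k.2 := by
  classical
  induction S using Finset.induction_on with
  | empty => exact ⟨g, hg, 0, by simp, by simp⟩
  | insert k S hk ih =>
    obtain ⟨P, hP, p, hp, hp'⟩ := ih (fun l hl => hS l (Finset.mem_insert_of_mem hl))
    refine ⟨P ⊞ (g⟦k.1⟧ : C), compact_biprod hP (compact_shift hg _), biprod.desc p k.2, ?_, ?_⟩
    · apply biprod.hom_ext'
      · simpa using hp
      · simpa using hS k (Finset.mem_insert_self _ _)
    · intro l hl
      rw [Finset.mem_insert] at hl
      rcases hl with rfl | hl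
      · exact ⟨biprod.inr, by simp⟩
      · obtain ⟨v, hv⟩ := hp' l hl
        exact ⟨v ≫ biprod.inl, by simpa using hv⟩

lemma exists_approx {g : C} (hg : IsCompactObj g) (y z : C) (w : y ⟶ z) (hy : FinHom R g y) :
    ∃ (P : C) (_ : IsCompactObj P) (p : P ⟶ y), p ≫ w = 0 ∧
      ∀ (i : ℤ) (u : (g⟦i⟧ : C) ⟶ y), u ≫ w = 0 → ∃ v, v ≫ p = u := by
  classical
  have : Module.Finite R (⨁ i : ℤ, ((g⟦i⟧ : C) ⟶ y)) := hy
  obtain ⟨S, hS⟩ := IsNoetherian.noetherian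
    (LinearMap.ker (DirectSum.lmap (fun i : ℤ => Linear.rightComp R (g⟦i⟧ : C) w)))
  have hSk : ∀ d ∈ S, ∀ i, d i ≫ w = 0 := by
    intro d hd i
    have : d ∈ LinearMap.ker (DirectSum.lmap (fun i : ℤ => Linear.rightComp R (g⟦i⟧ : C) w)) := by
      rw [← hS]; exact Submodule.subset_span hd
    exact DFunLike.congr_fun (LinearMap.mem_ker.1 this) i
  obtain ⟨P, hP, p, hp, hp'⟩ := exists_cover hg y z w
    (S.biUnion (fun d => d.support.image (fun i => ⟨i, d i⟩))) (by
      intro k hk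
      simp only [Finset.mem_biUnion, Finset.mem_image] at hk
      obtain ⟨d, hd, i, _, rfl⟩ := hk
      exact hSk d hd i)
  refine ⟨P, hP, p, hp, fun i u hu => ?_⟩
  have hle : LinearMap.ker (DirectSum.lmap (fun i : ℤ => Linear.rightComp R (g⟦i⟧ : C) w)) ≤
      LinearMap.range (DirectSum.lmap (fun i : ℤ => Linear.rightComp R (g⟦i⟧ : C) p)) := by
    rw [← hS, Submodule.span_le]
    intro d hd
    rw [DirectSum.range_lmap]
    intro i _
    by_cases hi : i ∈ d.support
    · obtain ⟨v, hv⟩ := hp' ⟨i, d i⟩ (Finset.mem_biUnion.2 ⟨d, hd, Finset.mem_image_of_mem _ hi⟩)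
      exact ⟨v, hv⟩
    · have : d i = 0 := by simpa using hi
      exact ⟨0, by simpa using this.symm⟩
  have hmem : DirectSum.of (fun i : ℤ => ((g⟦i⟧ : C) ⟶ y)) i u ∈
      LinearMap.ker (DirectSum.lmap (fun i : ℤ => Linear.rightComp R (g⟦i⟧ : C) w)) := by
    rw [LinearMap.mem_ker, DirectSum.lmap_of]
    simp [hu]
  have := hle hmem
  rw [DirectSum.range_lmap] at this
  obtain ⟨v, hv⟩ := this i trivial
  refine ⟨v, ?_⟩
  change v ≫ p = _ at hv
  rw [hv]
  exact DirectSum.of_eq_same _ _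

/-- every map to a coproduct factors through `w` up to a finite one -/
def Cfn {y z : C} (w : y ⟶ z) : Prop :=
  ∀ (J : Type v) (f : J → C) (h : y ⟶ ∐ f), ∃ h' : z ⟶ ∐ f, FinMap (h - w ≫ h')

lemma Cfn.comp {y z z' : C} {w : y ⟶ z} {w' : z ⟶ z'} (H : Cfn w) (H' : Cfn w') :
    Cfn (w ≫ w') := by
  intro J f h
  obtain ⟨h1, H1⟩ := H J f h
  obtain ⟨h2, H2⟩ := H' J f h1
  refine ⟨h2, ?_⟩
  have := H1.add (H2.precomp w)
  simpa using this

lemma ghost_step {g : C} (hg : IsCompactObj g)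
    (hN : ∀ c : C, IsCompactObj c → FinHom R g c) (y : C) (hy : FinHom R g y) :
    ∃ (z : C) (_ : FinHom R g z) (w : y ⟶ z), Gh g 0 w ∧ Cfn w := by
  obtain ⟨P, hP, p, -, hp⟩ := exists_approx R hg y y 0 hy
  obtain ⟨z, w, δ, hT⟩ := distinguished_cocone_triangle p
  refine ⟨z, ?_, w, ?_, ?_⟩
  · exact finHom_ext R _ _ _ (rot_of_distTriang _ hT) hy (hN _ (compact_shift hP 1))
  · refine gh_zero w (fun i v => ?_)
    obtain ⟨k, rfl⟩ := hp i v comp_zero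
    have : p ≫ w = 0 := comp_distTriang_mor_zero₁₂ _ hT
    rw [Category.assoc, this, comp_zero]
  · intro J f h
    exact tri_step p w δ hT hP f h

lemma ghost_steps {g : C} (hg : IsCompactObj g)
    (hN : ∀ c : C, IsCompactObj c → FinHom R g c) (n : ℕ) (y : C) (hy : FinHom R g y) :
    ∃ (z : C) (_ : FinHom R g z) (w : y ⟶ z), Gh g n w ∧ Cfn w := by
  induction n generalizing y with
  | zero => exact ghost_step R hg hN y hy
  | succ n ih =>
    obtain ⟨z, hz, w, h1, h2⟩ := ghost_step R hg hN y hy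
    obtain ⟨z', hz', w', h1', h2'⟩ := ih z hz
    have hghost := gh_succ w w' h1 h1'
    have hcomp : Cfn (w ≫ w') := h2.comp h2'
    refine ⟨z', hz', w ≫ w', ?_⟩
    exact ⟨hghost, hcomp⟩

/-- approximations of `x` by compact objects -/
structure Stage (x : C) where
  F : C
  f : F ⟶ x
  hF : IsCompactObj F

lemma stage_zero {g : C} (hg : IsCompactObj g) (x : C) (hx : FinHom R g x) :
    ∃ S : Stage x, ∀ (i : ℤ) (u : (g⟦i⟧ : C) ⟶ x), ∃ v, v ≫ S.f = u := by
  obtain ⟨P, hP, p, -, hp⟩ := exists_approx R hg x x 0 hx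
  exact ⟨⟨P, p, hP⟩, fun i u => hp i u comp_zero⟩

lemma stage_succ {g : C} (hg : IsCompactObj g)
    (hN : ∀ c : C, IsCompactObj c → FinHom R g c) (x : C) (S : Stage x) :
    ∃ (S' : Stage x) (t : S.F ⟶ S'.F), t ≫ S'.f = S.f ∧
      ∀ (i : ℤ) (u : (g⟦i⟧ : C) ⟶ S.F), u ≫ S.f = 0 → u ≫ t = 0 := by
  obtain ⟨Q, hQ, q, hq, hq'⟩ := exists_approx R hg S.F x S.f (hN _ S.hF)
  obtain ⟨F', t, δ, hT⟩ := distinguished_cocone_triangle q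
  obtain ⟨f', hf'⟩ := Triangle.yoneda_exact₂ _ hT S.f hq
  refine ⟨⟨F', f', compact_cone q t δ hT hQ S.hF⟩, t, hf'.symm, fun i u hu => ?_⟩
  obtain ⟨v, rfl⟩ := hq' i u hu
  have : q ≫ t = 0 := comp_distTriang_mor_zero₁₂ _ hT
  rw [Category.assoc]
  exact (congrArg (v ≫ ·) this).trans comp_zero

lemma exists_seq {g : C} (hg : IsCompactObj g)
    (hN : ∀ c : C, IsCompactObj c → FinHom R g c) (x : C) (hx : FinHom R g x) :
    ∃ (F : ℕ → C) (f : ∀ n, F n ⟶ x) (t : ∀ n, F n ⟶ F (n + 1)),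
      (∀ n, IsCompactObj (F n)) ∧ (∀ n, t n ≫ f (n + 1) = f n) ∧
      (∀ (i : ℤ) (u : (g⟦i⟧ : C) ⟶ x), ∃ v, v ≫ f 0 = u) ∧
      (∀ n (i : ℤ) (u : (g⟦i⟧ : C) ⟶ F n), u ≫ f n = 0 → u ≫ t n = 0) := by
  obtain ⟨S0, h0⟩ := stage_zero R hg x hx
  choose nx t h1 h2 using stage_succ R hg hN x
  let S : ℕ → Stage x := fun n => Nat.rec S0 (fun _ s => nx s) n
  exact ⟨fun n => (S n).F, fun n => (S n).f, fun n => t (S n), fun n => (S n).hF,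
    fun n => h1 (S n), h0, fun n => h2 (S n)⟩

end B

section D
variable [Preadditive C]
    [HasZeroObject C] [HasShift C ℤ] [∀ n : ℤ, (shiftFunctor C n).Additive]
    [Pretriangulated C] [HasCoproducts.{v} C]

lemma hocolim_tri {g : C} (hg : IsCompactObj g)
    (hgen : ∀ x : C, (∀ (n : ℤ) (f : (g⟦n⟧ : C) ⟶ x), f = 0) → IsZero x)
    (x : C) (F : ℕ → C) (f : ∀ n, F n ⟶ x) (t : ∀ n, F n ⟶ F (n + 1))
    (hf : ∀ n, t n ≫ f (n + 1) = f n)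
    (h0 : ∀ (i : ℤ) (u : (g⟦i⟧ : C) ⟶ x), ∃ v, v ≫ f 0 = u)
    (hk : ∀ n (i : ℤ) (u : (g⟦i⟧ : C) ⟶ F n), u ≫ f n = 0 → u ≫ t n = 0) :
    ∃ (δ : x ⟶ (∐ (fun n : ULift.{v} ℕ => F n.down))⟦(1 : ℤ)⟧),
      ∀ (y : C) (w : x ⟶ y), (∀ n, f n ≫ w = 0) → ∃ w', w = δ ≫ w' := by
  classical
  let J := ULift.{v} ℕ
  let FF : J → C := fun n => F n.down
  let ι : ∀ n : ℕ, F n ⟶ ∐ FF := fun n => Sigma.ι FF ⟨n⟩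
  let sh : ∐ FF ⟶ ∐ FF := Sigma.desc (fun n : J => t n.down ≫ ι (n.down + 1))
  have ι_sh : ∀ n, ι n ≫ sh = t n ≫ ι (n + 1) := fun n => by
    simp [ι, sh]
  let a : ∐ FF ⟶ ∐ FF := 𝟙 _ - sh
  let ff : ∐ FF ⟶ x := Sigma.desc (fun n : J => f n.down)
  have ι_ff : ∀ n, ι n ≫ ff = f n := fun n => by simp [ι, ff]
  have hext : ∀ {y : C} (p q : ∐ FF ⟶ y), (∀ n, ι n ≫ p = ι n ≫ q) → p = q :=
    fun p q h => Sigma.hom_ext _ _ (fun n => h n.down)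
  have aff : a ≫ ff = 0 := by
    refine hext _ _ (fun n => ?_)
    simp only [a, Preadditive.sub_comp, Category.id_comp, Preadditive.comp_sub, comp_zero]
    rw [← Category.assoc, ι_sh, Category.assoc, ι_ff, ι_ff, hf, sub_self]
  obtain ⟨Y, b, δ, hT⟩ := distinguished_cocone_triangle a
  obtain ⟨r, hr⟩ : ∃ r : Y ⟶ x, ff = b ≫ r := Triangle.yoneda_exact₂ _ hT ff aff
  have hab : a ≫ b = 0 := comp_distTriang_mor_zero₁₂ _ hT
  have ι_b : ∀ n, ι n ≫ b = t n ≫ ι (n + 1) ≫ b := by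
    intro n
    have := congrArg (ι n ≫ ·) hab
    simp only [a, Preadditive.sub_comp, Category.id_comp, Preadditive.comp_sub, comp_zero,
      sub_eq_zero] at this
    rw [this, ← Category.assoc, ι_sh, Category.assoc]
  -- injectivity of `a`
  have sh_π0 : sh ≫ Sigma.π FF ⟨0⟩ = 0 := by
    refine hext _ _ (fun n => ?_)
    rw [← Category.assoc, ι_sh, Category.assoc]
    simp only [ι]
    rw [Sigma.ι_π_of_ne]
    · simp
    · intro h; simpa using congrArg ULift.down h
  have sh_π : ∀ n, sh ≫ Sigma.π FF ⟨n + 1⟩ = Sigma.π FF ⟨n⟩ ≫ t n := by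
    intro n
    refine hext _ _ (fun m => ?_)
    rw [← Category.assoc, ι_sh, Category.assoc]
    simp only [ι]
    by_cases hmn : m = n
    · subst hmn
      rw [Sigma.ι_π_eq_id, ← Category.assoc, Sigma.ι_π_eq_id]
      exact (Category.comp_id _).trans (Category.id_comp _).symm
    · rw [Sigma.ι_π_of_ne, ← Category.assoc, Sigma.ι_π_of_ne]
      · simp
      · intro h; exact hmn (congrArg ULift.down h)
      · intro h; exact hmn (by simpa using congrArg ULift.down h)
  have hinj : ∀ (c : C), IsCompactObj c → ∀ u : c ⟶ ∐ FF, u ≫ a = 0 → u = 0 := by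
    intro c hc u hu
    have hu' : u = u ≫ sh := by
      simpa [a, Preadditive.comp_sub, sub_eq_zero] using hu
    have hz : ∀ n, u ≫ Sigma.π FF ⟨n⟩ = 0 := by
      intro n
      induction n with
      | zero => rw [hu', Category.assoc, sh_π0, comp_zero]
      | succ n ih => rw [hu', Category.assoc, sh_π, ← Category.assoc, ih, zero_comp]
    obtain ⟨s, hs⟩ := (isCompactObj_iff c).1 hc J FF u
    rw [← hs, tr_eq_sum, Preadditive.comp_sum]
    refine Finset.sum_eq_zero (fun j _ => ?_)
    rw [← Category.assoc, hz j.down, zero_comp]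
  -- every map from a compact object comes from a finite stage
  have push : ∀ (n N : ℕ), n ≤ N → ∃ τ : F n ⟶ F N, ι n ≫ b = τ ≫ ι N ≫ b ∧ τ ≫ f N = f n := by
    intro n N h
    induction h with
    | refl => exact ⟨𝟙 _, by simp, by simp⟩
    | step _ ih =>
      obtain ⟨τ, h1, h2⟩ := ih
      refine ⟨τ ≫ t _, ?_, ?_⟩
      · rw [h1, ι_b, Category.assoc]
      · rw [Category.assoc, hf, h2]
  have fin : ∀ (c : C), IsCompactObj c → ∀ u : c ⟶ ∐ FF,
      ∃ (N : ℕ) (v : c ⟶ F N), u ≫ b = v ≫ ι N ≫ b ∧ u ≫ ff = v ≫ f N := by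
    intro c hc u
    obtain ⟨s, hs⟩ := (isCompactObj_iff c).1 hc J FF u
    let N := s.sup ULift.down
    choose! τ h1 h2 using fun (n : ℕ) (h : n ≤ N) => push n N h
    refine ⟨N, ∑ j ∈ s, (u ≫ Sigma.π FF j) ≫ τ j.down, ?_, ?_⟩
    · conv_lhs => rw [← hs, tr_eq_sum]
      simp only [Preadditive.comp_sum, Preadditive.sum_comp]
      refine Finset.sum_congr rfl (fun j hj => ?_)
      have := h1 j.down (Finset.le_sup (f := ULift.down) hj)
      simp only [Category.assoc]
      rw [← this]
    · conv_lhs => rw [← hs, tr_eq_sum]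
      simp only [Preadditive.comp_sum, Preadditive.sum_comp]
      refine Finset.sum_congr rfl (fun j hj => ?_)
      have := h2 j.down (Finset.le_sup (f := ULift.down) hj)
      simp only [Category.assoc]
      rw [this]
      congr 2
      exact ι_ff j.down
  have rinj : ∀ (i : ℤ) (u : (g⟦i⟧ : C) ⟶ Y), u ≫ r = 0 → u = 0 := by
    intro i u hu
    have h1 : u ≫ δ = 0 := by
      let e : ((g⟦i - 1⟧ : C)⟦(1 : ℤ)⟧) ≅ (g⟦i⟧ : C) :=
        (shiftFunctorAdd' C (i - 1) 1 i (by ring)).symm.app g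
      obtain ⟨k, hk⟩ := (shiftFunctor C (1 : ℤ)).map_surjective (e.hom ≫ u ≫ δ)
      have hδ : δ ≫ a⟦(1 : ℤ)⟧' = 0 := comp_distTriang_mor_zero₃₁ _ hT
      have : k ≫ a = 0 := by
        apply (shiftFunctor C (1 : ℤ)).map_injective
        rw [Functor.map_comp, hk]
        simp [hδ]
      have hk0 := hinj _ (compact_shift hg _) k this
      rw [hk0, Functor.map_zero] at hk
      rw [← cancel_epi e.hom, ← hk, comp_zero]
    obtain ⟨k, rfl⟩ : ∃ k : (g⟦i⟧ : C) ⟶ ∐ FF, u = k ≫ b := Triangle.coyoneda_exact₃ _ hT u h1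
    obtain ⟨N, v, hv1, hv2⟩ := fin _ (compact_shift hg i) k
    have : v ≫ f N = 0 := by
      rw [← hv2, hr, ← Category.assoc, hu]
    rw [hv1, ι_b, ← Category.assoc, hk N i v this, zero_comp]
  have hiso : IsIso r := by
    obtain ⟨z, q, ε, hT'⟩ := distinguished_cocone_triangle r
    refine (Triangle.isZero₃_iff_isIso₁ _ hT').1 (hgen z (fun i u => ?_))
    have h1 : u ≫ ε = 0 := by
      let e : ((g⟦i - 1⟧ : C)⟦(1 : ℤ)⟧) ≅ (g⟦i⟧ : C) :=
        (shiftFunctorAdd' C (i - 1) 1 i (by ring)).symm.app g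
      obtain ⟨k, hk⟩ := (shiftFunctor C (1 : ℤ)).map_surjective (e.hom ≫ u ≫ ε)
      have hδ : ε ≫ r⟦(1 : ℤ)⟧' = 0 := comp_distTriang_mor_zero₃₁ _ hT'
      have : k ≫ r = 0 := by
        apply (shiftFunctor C (1 : ℤ)).map_injective
        rw [Functor.map_comp, hk]
        simp [hδ]
      have hk0 := rinj _ k this
      rw [hk0, Functor.map_zero] at hk
      rw [← cancel_epi e.hom, ← hk, comp_zero]
    obtain ⟨k, rfl⟩ : ∃ k : (g⟦i⟧ : C) ⟶ x, u = k ≫ q := Triangle.coyoneda_exact₃ _ hT' u h1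
    obtain ⟨v, rfl⟩ := h0 i k
    have hrq : r ≫ q = 0 := comp_distTriang_mor_zero₁₂ _ hT'
    rw [← ι_ff, hr]
    simp [hrq]
  refine ⟨inv r ≫ δ, fun y w hw => ?_⟩
  have hbw : b ≫ r ≫ w = 0 := by
    rw [← Category.assoc, ← hr]
    refine hext _ _ (fun n => ?_)
    rw [← Category.assoc, ι_ff, hw, comp_zero]
  obtain ⟨w', hw'⟩ : ∃ w' : (∐ FF)⟦(1 : ℤ)⟧ ⟶ y, r ≫ w = δ ≫ w' :=
    Triangle.yoneda_exact₃ _ hT (r ≫ w) hbw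
  exact ⟨w', by rw [Category.assoc, ← hw', IsIso.inv_hom_id_assoc]⟩

lemma shift_coprod_ext {J : Type v} (f : J → C) {y : C} (w : (∐ f)⟦(1 : ℤ)⟧ ⟶ y)
    (h : ∀ j, (Sigma.ι f j)⟦(1 : ℤ)⟧' ≫ w = 0) : w = 0 := by
  rw [← cancel_epi (sigmaComparison (shiftFunctor C (1 : ℤ)) f)]
  refine Sigma.hom_ext _ _ (fun j => ?_)
  rw [← Category.assoc, ι_comp_sigmaComparison, h]
  simp

end D

end Helpers

/-- Let `R` be a commutative Noetherian ring and `C` an `R`-linear pretriangulated category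
with arbitrary coproducts such that (1) for all compact objects `c, c'` the graded Hom
`⨁_{i∈ℤ} Hom(c⟦i⟧, c')` is a finitely generated `R`-module; (2) there is a compact object
`g` and `D ∈ ℕ` such that every compact object of `C` lies in `thick^D(g)`; and (3) `g`
generates `C`. Then every object `x` of `C` such that `⨁_{i∈ℤ} Hom(c⟦i⟧, x)` is a finitely
generated `R`-module for every compact object `c` is itself compact; in fact every such `x`
lies in `thick^{2D+1}(g)`. -/
theorem compact_of_finite_homs
    (R : Type u₁) [CommRing R] [IsNoetherianRing R]
    {C : Type u} [Category.{v} C] [Preadditive C] [CategoryTheory.Linear R C]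
    [HasZeroObject C] [HasShift C ℤ] [∀ n : ℤ, (shiftFunctor C n).Additive]
    [Pretriangulated C] [HasCoproducts.{v} C]
    (hNoeth : ∀ c c' : C, IsCompactObj c → IsCompactObj c' →
      Module.Finite R (⨁ i : ℤ, ((c⟦i⟧ : C) ⟶ c')))
    (g : C) (hgc : IsCompactObj g) (D : ℕ)
    (hstrong : ∀ c : C, IsCompactObj c → c ∈ thickLevel g D)
    (hgen : ∀ x : C, (∀ (n : ℤ) (f : (g⟦n⟧ : C) ⟶ x), f = 0) → IsZero x)
    (x : C) (hx : ∀ c : C, IsCompactObj c → Module.Finite R (⨁ i : ℤ, ((c⟦i⟧ : C) ⟶ x))) :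
    IsCompactObj x ∧ x ∈ thickLevel g (2 * D + 1) := by
  have hN : ∀ c : C, IsCompactObj c → FinHom R g c := fun c hc => hNoeth g c hgc hc
  suffices hc : IsCompactObj x from ⟨hc, thick_le (by omega) (hstrong x hc)⟩
  obtain ⟨y, hy, w, hw, hw'⟩ := ghost_steps R hgc hN D x (hx g hgc)
  obtain ⟨z, hz, k, hk, hk'⟩ := ghost_steps R hgc hN D y hy
  have hzero : w ≫ k = 0 := by
    obtain ⟨F, f, t, hF, hf, h0, h1⟩ := exists_seq R hgc hN x (hx g hgc)
    obtain ⟨δ, hδ⟩ := hocolim_tri hgc hgen x F f t hf h0 h1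
    obtain ⟨w', rfl⟩ := hδ y w (fun n => hw _ (hstrong _ (hF n)) _)
    have : w' ≫ k = 0 := by
      refine shift_coprod_ext _ _ (fun j => ?_)
      rw [← Category.assoc]
      exact hk _ (hstrong _ (compact_shift (hF j.down) 1)) _
    rw [Category.assoc, this, comp_zero]
  rw [isCompactObj_iff]
  intro J f h
  obtain ⟨h', H⟩ := hw'.comp hk' J f h
  rwa [hzero, zero_comp, sub_zero] at H

end TTGStmt5
end

section
/- Let (M_{(m,l)}) be an inverse system of abelian groups indexed by ℕ × ℕ with the componentwise partial order. Assume that: (1) for each fixed l ∈ ℕ, the ℕ-indexed inverse system (M_{(m,l)})_{m∈ℕ} is Mittag-Leffler; and (2) the ℕ-indexed inverse system (lim_m M_{(m,l)})_{l∈ℕ}, whose transition maps are induced by those of the double system, is Mittag-Leffler. Then the ℕ×ℕ-indexed inverse system (M_{(m,l)}) is Mittag-Leffler. -/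
namespace TTGStmt7

variable (M : ℕ × ℕ → Type*) [∀ p, AddCommGroup (M p)]
variable (f : ∀ ⦃p q : ℕ × ℕ⦄, p ≤ q → (M q →+ M p))

/-- Compatible families at level `l`, i.e. elements of the inverse limit `lim_m M (m, l)`
of the `m`-th column of the double system. -/
def IsCompat (l : ℕ) (x : ∀ m, M (m, l)) : Prop :=
  ∀ ⦃m m' : ℕ⦄ (h : m ≤ m'),
    f (Prod.mk_le_mk.mpr ⟨h, le_rfl⟩) (x m') = x m

/-- The (underlying set of the) image of the induced transition map
`lim_m M (m, l') → lim_m M (m, l)` of the inverse system of inverse limits. -/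
def limImage {l l' : ℕ} (h : l ≤ l') : Set (∀ m, M (m, l)) :=
  {y | ∃ x : ∀ m, M (m, l'), IsCompat M f l' x ∧
    ∀ m, f (Prod.mk_le_mk.mpr ⟨le_rfl, h⟩) (x m) = y m}

/-- Mittag-Leffler lifting for one fixed `l`: an element of the image of the transition map
from a stable index lifts to a compatible family. -/
theorem exists_compat
    (hid : ∀ p : ℕ × ℕ, f (le_refl p) = AddMonoidHom.id (M p))
    (hcomp : ∀ ⦃p q r : ℕ × ℕ⦄ (hpq : p ≤ q) (hqr : q ≤ r),
      (f hpq).comp (f hqr) = f (hpq.trans hqr))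
    (l : ℕ)
    (h1 : ∀ m : ℕ, ∃ (m' : ℕ) (hm : m ≤ m'), ∀ (m'' : ℕ) (hm' : m' ≤ m''),
      Set.range (f (Prod.mk_le_mk.mpr ⟨hm.trans hm', le_rfl⟩ :
          ((m, l) : ℕ × ℕ) ≤ (m'', l))) =
        Set.range (f (Prod.mk_le_mk.mpr ⟨hm, le_rfl⟩ : ((m, l) : ℕ × ℕ) ≤ (m', l))))
    (m : ℕ) (a : M (m, l))
    (ha : ∀ (k : ℕ) (h : ((m, l) : ℕ × ℕ) ≤ (k, l)), a ∈ Set.range (f h)) :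
    ∃ x : ∀ k, M (k, l), IsCompat M f l x ∧ x m = a := by
  have hc : ∀ {p q r : ℕ × ℕ} (hpq : p ≤ q) (hqr : q ≤ r) (z : M r),
      f hpq (f hqr z) = f (hpq.trans hqr) z := fun hpq hqr z =>
    DFunLike.congr_fun (hcomp hpq hqr) z
  have hle : ∀ {k k' : ℕ}, k ≤ k' → ((k, l) : ℕ × ℕ) ≤ (k', l) :=
    fun h => Prod.mk_le_mk.mpr ⟨h, le_rfl⟩
  let S : ∀ k, M (k, l) → Prop := fun k a =>
    ∀ (k' : ℕ) (h : ((k, l) : ℕ × ℕ) ≤ (k', l)), a ∈ Set.range (f h)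
  have step : ∀ k (a : M (k, l)), S k a →
      ∃ b : M (k + 1, l), S (k + 1) b ∧ f (hle (Nat.le_succ k)) b = a := by
    intro k a ha
    obtain ⟨K, hK, hst⟩ := h1 (k + 1)
    obtain ⟨c, rfl⟩ := ha K (hle (by omega))
    refine ⟨f (hle hK) c, ?_, hc _ _ _⟩
    intro k' h
    have h3 : f (hle hK) c ∈ Set.range (f (hle (hK.trans (le_max_left K k')))) := by
      rw [hst _ (le_max_left K k')]
      exact ⟨c, rfl⟩
    obtain ⟨d, hd⟩ := h3
    refine ⟨f (hle (le_max_right K k')) d, ?_⟩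
    rw [hc, ← hd]
  choose nx hnxS hnx using step
  let g : ∀ n, {b : M (m + n, l) // S (m + n) b} := fun n =>
    Nat.rec (motive := fun n => {b : M (m + n, l) // S (m + n) b}) ⟨a, ha⟩
      (fun n b => ⟨nx (m + n) b.1 b.2, hnxS (m + n) b.1 b.2⟩) n
  have gs : ∀ n, f (hle (Nat.le_succ (m + n))) (g (n + 1)).1 = (g n).1 := fun n =>
    hnx (m + n) (g n).1 (g n).2
  have gle : ∀ n n' (h : n ≤ n'), f (hle (Nat.add_le_add_left h m)) (g n').1 = (g n).1 := by
    intro n n' h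
    induction n', h using Nat.le_induction with
    | base => rw [hid]; rfl
    | succ n' h ih =>
      rw [← ih, ← gs n', hc]
  refine ⟨fun k => f (hle (Nat.le_add_left k m)) (g k).1, ?_, ?_⟩
  · intro k k' h
    rw [hc]
    beta_reduce
    rw [← gle k k' h, hc]
  · exact gle 0 m (Nat.zero_le m)

/-- Let `(M (m,l))` be an inverse system of abelian groups indexed by `ℕ × ℕ` with the
componentwise partial order. Assume that (1) for each fixed `l`, the `ℕ`-indexed inverse
system `(M (m,l))_m` is Mittag-Leffler, and (2) the `ℕ`-indexed inverse system
`(lim_m M (m,l))_l` of inverse limits, with the induced transition maps, is Mittag-Leffler.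
Then the `ℕ×ℕ`-indexed inverse system `(M (m,l))` is Mittag-Leffler. -/
theorem mittagLeffler_of_rows_and_limits
    (hid : ∀ p : ℕ × ℕ, f (le_refl p) = AddMonoidHom.id (M p))
    (hcomp : ∀ ⦃p q r : ℕ × ℕ⦄ (hpq : p ≤ q) (hqr : q ≤ r),
      (f hpq).comp (f hqr) = f (hpq.trans hqr))
    (h1 : ∀ l m : ℕ, ∃ (m' : ℕ) (hm : m ≤ m'), ∀ (m'' : ℕ) (hm' : m' ≤ m''),
      Set.range (f (Prod.mk_le_mk.mpr ⟨hm.trans hm', le_rfl⟩ :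
          ((m, l) : ℕ × ℕ) ≤ (m'', l))) =
        Set.range (f (Prod.mk_le_mk.mpr ⟨hm, le_rfl⟩ : ((m, l) : ℕ × ℕ) ≤ (m', l))))
    (h2 : ∀ l : ℕ, ∃ (l' : ℕ) (hl : l ≤ l'), ∀ (l'' : ℕ) (hl' : l' ≤ l''),
      limImage M f (hl.trans hl') = limImage M f hl) :
    ∀ p : ℕ × ℕ, ∃ (q : ℕ × ℕ) (hpq : p ≤ q), ∀ (r : ℕ × ℕ) (hqr : q ≤ r),
      Set.range (f (hpq.trans hqr)) = Set.range (f hpq) := by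
  have hc : ∀ {p q r : ℕ × ℕ} (hpq : p ≤ q) (hqr : q ≤ r) (z : M r),
      f hpq (f hqr z) = f (hpq.trans hqr) z := fun hpq hqr z =>
    DFunLike.congr_fun (hcomp hpq hqr) z
  rintro ⟨m, l⟩
  obtain ⟨l', hl, hl'⟩ := h2 l
  obtain ⟨m', hm, hm'⟩ := h1 l' m
  refine ⟨(m', l'), Prod.mk_le_mk.mpr ⟨hm, hl⟩, ?_⟩
  rintro ⟨m'', l''⟩ hqr
  obtain ⟨hqm, hql⟩ := Prod.mk_le_mk.mp hqr
  apply Set.Subset.antisymm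
  · rintro _ ⟨z, rfl⟩
    exact ⟨f hqr z, hc _ _ _⟩
  rintro _ ⟨z, rfl⟩
  have hmm : ((m, l') : ℕ × ℕ) ≤ (m', l') := Prod.mk_le_mk.mpr ⟨hm, le_rfl⟩
  have hll : ((m, l) : ℕ × ℕ) ≤ (m, l') := Prod.mk_le_mk.mpr ⟨le_rfl, hl⟩
  obtain ⟨x, hx, hxm⟩ := exists_compat M f hid hcomp l' (h1 l') m (f hmm z) (by
    intro k h
    have h3 : f hmm z ∈ Set.range (f (Prod.mk_le_mk.mpr
        ⟨hm.trans (le_max_left m' k), le_rfl⟩ : ((m, l') : ℕ × ℕ) ≤ (max m' k, l'))) := by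
      rw [hm' _ (le_max_left m' k)]
      exact ⟨z, rfl⟩
    obtain ⟨d, hd⟩ := h3
    refine ⟨f (Prod.mk_le_mk.mpr ⟨le_max_right m' k, le_rfl⟩ :
      ((k, l') : ℕ × ℕ) ≤ (max m' k, l')) d, ?_⟩
    rw [hc, ← hd])
  have hy : (fun k => f (Prod.mk_le_mk.mpr ⟨le_rfl, hl⟩ : ((k, l) : ℕ × ℕ) ≤ (k, l')) (x k))
      ∈ limImage M f hl := ⟨x, hx, fun _ => rfl⟩
  rw [← hl' l'' hql] at hy
  obtain ⟨w, hw, hwx⟩ := hy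
  refine ⟨w m'', ?_⟩
  have e1 := hwx m
  have e2 := hw (hm.trans hqm)
  rw [← e2, hc] at e1
  simp only [hxm, hc] at e1
  exact e1

end TTGStmt7
end

section
/- Let C be an AB5 abelian category with Ext-groups, let M : ℕ ⥤ C be a sequential direct system with transition maps u_i : M_i → M_{i+1}, colimit c, and colimit cocone maps ι_i : M_i → c, and let N be an object of C. Let (e_i)_{i∈ℕ} be a family of classes e_i ∈ Ext¹(M_i, N) which is compatible, i.e. for every i the pullback of e_{i+1} along u_i equals e_i. Then there exists a class E ∈ Ext¹(c, N) whose pullback along ι_i equals e_i for every i. (This is the surjectivity of the canonical map Ext¹(colim_i M_i, N) → lim_i Ext¹(M_i, N) appearing in the paper's lim¹-Ext exact sequence.) -/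
open CategoryTheory CategoryTheory.Limits CategoryTheory.Abelian

universe w v u

theorem comp_shift_id_eq {D : Type u} [Category.{v} D] [HasShift D ℤ] {A B : D}
    (a : A ⟶ B⟦(1 : ℤ)⟧) : a ≫ (𝟙 B)⟦(1 : ℤ)⟧' = a := by
  simp

open DerivedCategory Pretriangulated in
theorem exists_shortExact_extClass_eq
    {C : Type u} [Category.{v} C] [Abelian C] [HasExt.{w} C] {X N : C} (x : Ext X N 1) :
    ∃ (E : C) (f : N ⟶ E) (g : E ⟶ X) (w : f ≫ g = 0)
      (h : (ShortComplex.mk f g w).ShortExact), h.extClass = x := by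
  let := HasDerivedCategory.standard C
  obtain ⟨Y, f', g', mem⟩ := distinguished_cocone_triangle₂ (C := DerivedCategory C)
    (show (singleFunctor C 0).obj X ⟶ ((singleFunctor C 0).obj N)⟦(1 : ℤ)⟧ from x.hom)
  have h1 : Y.IsLE 0 := TStructure.t.isLE₂ _ mem 0
    (inferInstanceAs (((singleFunctor C 0).obj N).IsLE 0))
    (inferInstanceAs (((singleFunctor C 0).obj X).IsLE 0))
  have h2 : Y.IsGE 0 := TStructure.t.isGE₂ _ mem 0
    (inferInstanceAs (((singleFunctor C 0).obj N).IsGE 0))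
    (inferInstanceAs (((singleFunctor C 0).obj X).IsGE 0))
  obtain ⟨E, ⟨eY⟩⟩ := exists_iso_singleFunctor_obj_of_isGE_of_isLE Y 0
  obtain ⟨f, hf⟩ := (singleFunctor C 0).map_surjective (f' ≫ eY.hom)
  obtain ⟨g, hg⟩ := (singleFunctor C 0).map_surjective (eY.inv ≫ g')
  have mem' : Triangle.mk ((singleFunctor C 0).map f) ((singleFunctor C 0).map g)
      (show (singleFunctor C 0).obj X ⟶ ((singleFunctor C 0).obj N)⟦(1 : ℤ)⟧ from x.hom)
      ∈ distTriang (DerivedCategory C) := by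
    refine isomorphic_distinguished _ mem _ ?_
    refine Triangle.isoMk _ _ (Iso.refl _) eY.symm (Iso.refl _) ?_ ?_ ?_
    · change (singleFunctor C 0).map f ≫ eY.inv = 𝟙 ((singleFunctor C 0).obj N) ≫ f'
      simp [hf]
    · change (singleFunctor C 0).map g ≫ 𝟙 ((singleFunctor C 0).obj X) = eY.inv ≫ g'
      simp [hg]
    · exact (comp_shift_id_eq _).trans (Category.id_comp _).symm
  have w : f ≫ g = 0 := by
    apply (singleFunctor C 0).map_injective
    rw [Functor.map_comp, Functor.map_zero]
    exact comp_distTriang_mor_zero₁₂ _ mem'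
  let S := ShortComplex.mk f g w
  let F := singleFunctor C 0 ⋙ homologyFunctor C 0
  have : F.PreservesZeroMorphisms := by dsimp [F]; infer_instance
  have hS' : (S.map F).ShortExact :=
    { exact := HomologySequence.exact₂ _ mem' 0
      mono_f := (HomologySequence.mono_homologyMap_mor₁_iff _ mem' (-1) 0 (by lia)).2
        (IsZero.eq_of_src (isZero_of_isGE ((singleFunctor C 0).obj X) 0 (-1) (by lia)) _ _)
      epi_g := (HomologySequence.epi_homologyMap_mor₂_iff _ mem' 0 1 (by lia)).2
        (IsZero.eq_of_tgt (isZero_of_isLE ((singleFunctor C 0).obj N) 0 1 (by lia)) _ _) }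
  have hS : S.ShortExact := by
    let i := singleFunctorCompHomologyFunctorIso C 0
    refine ShortComplex.shortExact_of_iso
      (ShortComplex.isoMk (i.app _) (i.app _) (i.app _) ?_ ?_) hS'
    · exact (i.hom.naturality f).symm
    · exact (i.hom.naturality g).symm
  refine ⟨E, f, g, w, hS, ?_⟩
  ext
  rw [hS.extClass_hom]
  obtain ⟨c, hc1, hc2⟩ := complete_distinguished_triangle_morphism _ _
    hS.singleTriangle_distinguished mem' (𝟙 _) (𝟙 _) 
    ((Category.comp_id _).trans (Category.id_comp _).symm)
  obtain ⟨c, rfl⟩ := (singleFunctor C 0).map_surjective c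
  have : c = 𝟙 X := by
    have := hS.epi_g
    have e : g ≫ c = g ≫ 𝟙 X := by
      apply (singleFunctor C 0).map_injective
      rw [Functor.map_comp, Category.comp_id]
      exact hc1.trans (Category.id_comp _)
    exact (cancel_epi S.g).1 e
  subst this
  refine (comp_shift_id_eq _).symm.trans (hc2.trans ?_)
  change (singleFunctor C 0).map (𝟙 X) ≫
    (show (singleFunctor C 0).obj X ⟶ ((singleFunctor C 0).obj N)⟦(1 : ℤ)⟧ from x.hom) = x.hom
  rw [CategoryTheory.Functor.map_id]
  exact Category.id_comp _

theorem exists_hom_of_ext_eq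
    {C : Type u} [Category.{v} C] [Abelian C] [HasExt.{w} C] {X X' N E E' : C}
    {f : N ⟶ E} {g : E ⟶ X} {w : f ≫ g = 0} (h : (ShortComplex.mk f g w).ShortExact)
    {f' : N ⟶ E'} {g' : E' ⟶ X'} {w' : f' ≫ g' = 0}
    (h' : (ShortComplex.mk f' g' w').ShortExact) (u : X ⟶ X')
    (hu : (Ext.mk₀ u).comp h'.extClass (zero_add 1) = h.extClass) :
    ∃ φ : E ⟶ E', f ≫ φ = f' ∧ φ ≫ g' = g ≫ u := by
  have hm : Mono f' := h'.mono_f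
  obtain ⟨y, hy⟩ := Ext.covariant_sequence_exact₃ E h' (Ext.mk₀ (g ≫ u)) (zero_add 1) (by
    have := h.comp_extClass
    rw [← hu] at this
    simpa using this)
  obtain ⟨φ, rfl⟩ := (Ext.mk₀_bijective _ _).2 y
  rw [Ext.mk₀_comp_mk₀] at hy
  have hφ : φ ≫ g' = g ≫ u := (Ext.mk₀_bijective _ _).1 hy
  let a : N ⟶ N := h'.exact.lift (f ≫ φ) (by simp [hφ, reassoc_of% w])
  have ha : a ≫ f' = f ≫ φ := h'.exact.lift_f _ _
  have nat := ShortComplex.ShortExact.extClass_naturality h h'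
    { τ₁ := a, τ₂ := φ, τ₃ := u, comm₁₂ := ha, comm₂₃ := hφ }
  dsimp at nat
  rw [hu] at nat
  obtain ⟨y, hy⟩ := Ext.contravariant_sequence_exact₁ h N (Ext.mk₀ (a - 𝟙 N)) (add_zero 1) (by
    rw [sub_eq_add_neg, Ext.mk₀_add, Ext.mk₀_neg, Ext.comp_add, Ext.comp_neg, nat]
    simp)
  obtain ⟨b, rfl⟩ := (Ext.mk₀_bijective _ _).2 y
  rw [Ext.mk₀_comp_mk₀] at hy
  have hb : f ≫ b = a - 𝟙 N := (Ext.mk₀_bijective _ _).1 hy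
  refine ⟨φ - b ≫ f', ?_, ?_⟩
  · rw [Preadditive.comp_sub, ← Category.assoc, hb, Preadditive.sub_comp, ha]; simp
  · simp [hφ, w']

theorem ext_final_computation
    {C : Type u} [Category.{v} C] [Abelian C] [HasExt.{w} C] {X N Q P L : C}
    (x : Ext X N 1) (i : X ⟶ P) (d : P ⟶ L) (j : X ⟶ L) (hj : i ≫ d = j)
    (T : Ext L Q 1) (q : Q ⟶ N) (k : N ⟶ Q) (hk : k ≫ q = 𝟙 N)
    (nat : x.comp (Ext.mk₀ k) (add_zero 1) = (Ext.mk₀ j).comp T (zero_add 1)) :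
    (Ext.mk₀ i).comp ((Ext.mk₀ d).comp (T.comp (Ext.mk₀ q) (add_zero 1)) (zero_add 1))
      (zero_add 1) = x := by
  rw [Ext.mk₀_comp_mk₀_assoc, hj, ← Ext.comp_assoc_of_third_deg_zero, ← nat,
    Ext.comp_assoc_of_third_deg_zero, Ext.mk₀_comp_mk₀, hk, Ext.comp_mk₀_id]

/-- Let `C` be an AB5 abelian category with Ext-groups, let `M : ℕ ⥤ C` be a sequential
direct system with colimit cocone `cc` (so `cc.pt` is the colimit and `cc.ι.app i` the
cocone maps), and let `N` be an object of `C`. Let `(e i)` be a compatible family of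
classes `e i ∈ Ext¹(M i, N)`, i.e. the pullback of `e (i+1)` along the transition map
`M i ⟶ M (i+1)` equals `e i` for every `i`. Then there is a class `E ∈ Ext¹(cc.pt, N)`
whose pullback along `cc.ι.app i` equals `e i` for every `i`.
(This is the surjectivity of the canonical map
`Ext¹(colim M, N) → lim_i Ext¹(M i, N)`.) -/
theorem ext_one_surjective_onto_lim
    {C : Type u} [Category.{v} C] [Abelian C] [HasColimits C]
    [HasFilteredColimits C] [AB5 C] [HasExt.{w} C]
    (M : ℕ ⥤ C) (N : C) (cc : Cocone M) (hcc : IsColimit cc)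
    (e : ∀ i : ℕ, Ext (M.obj i) N 1)
    (hcompat : ∀ i : ℕ,
      (Ext.mk₀ (M.map (homOfLE (Nat.le_succ i)))).comp (e (i + 1)) (zero_add 1) = e i) :
    ∃ E : Ext cc.pt N 1,
      ∀ i : ℕ, (Ext.mk₀ (cc.ι.app i)).comp E (zero_add 1) = e i := by
  choose E f g w h he using fun i => exists_shortExact_extClass_eq (e i)
  choose φ hφ₁ hφ₂ using fun i => exists_hom_of_ext_eq (h i) (h (i + 1))
    (M.map (homOfLE (Nat.le_succ i))) (by rw [he, he, hcompat])
  let F : ℕ ⥤ C := Functor.ofSequence φ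
  let α : (Functor.const ℕ).obj N ⟶ F := NatTrans.ofSequence (fun i => f i) (fun i => by
    rw [Functor.ofSequence_map_homOfLE_succ]
    exact (Category.id_comp _).trans (hφ₁ i).symm)
  let β : F ⟶ M := NatTrans.ofSequence (fun i => g i) (fun i => by
    rw [Functor.ofSequence_map_homOfLE_succ]
    exact hφ₂ i)
  let S : ShortComplex (ℕ ⥤ C) := ShortComplex.mk α β (by ext i; exact w i)
  have hSi (i : ℕ) : (S.map ((evaluation ℕ C).obj i)).ShortExact := h i
  have hS : S.ShortExact :=
    { exact := by
        rw [ShortComplex.exact_iff_isZero_homology]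
        refine Functor.isZero _ fun i => ?_
        exact ((ShortComplex.exact_iff_isZero_homology _).1 (hSi i).exact).of_iso
          (S.mapHomologyIso ((evaluation ℕ C).obj i)).symm
      mono_f := by
        have (i : ℕ) : Mono (S.f.app i) := (hSi i).mono_f
        exact NatTrans.mono_of_mono_app _
      epi_g := by
        have (i : ℕ) : Epi (S.g.app i) := (hSi i).epi_g
        exact NatTrans.epi_of_epi_app _ }
  have : HasFilteredColimitsOfSize.{0, 0} C := inferInstance
  have : AB5OfSize.{0, 0} C := AB5OfSize_of_univLE.{0, 0, v, v} C
  have hc : (S.map (colim (J := ℕ) (C := C))).ShortExact := hS.map_of_exact _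
  let q : colimit ((Functor.const ℕ).obj N) ⟶ N :=
    colimit.desc _ { pt := N, ι := 𝟙 _ }
  refine ⟨(Ext.mk₀ (hcc.desc (colimit.cocone M))).comp
    (hc.extClass.comp (Ext.mk₀ q) (add_zero 1)) (zero_add 1), fun i => ?_⟩
  have nat := ShortComplex.ShortExact.extClass_naturality (h i) hc
    { τ₁ := colimit.ι ((Functor.const ℕ).obj N) i, τ₂ := colimit.ι F i, τ₃ := colimit.ι M i
      comm₁₂ := by
        exact colimit.ι_desc _ _
      comm₂₃ := by
        exact colimit.ι_desc _ _ }
  rw [he] at nat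
  exact ext_final_computation (e i) _ _ (colimit.ι M i) (hcc.fac _ i) hc.extClass q _
    (colimit.ι_desc _ _) nat
end

section
/- Let C be an AB5 abelian category with Ext-groups, let M : ℕ ⥤ C be a sequential direct system with transition maps u_i : M_i → M_{i+1}, colimit c, and colimit cocone maps ι_i : M_i → c, and let N be an object of C. Assume that lim¹ of the inverse system of abelian groups (Hom(M_i, N)) vanishes, concretely: for every family of morphisms (g_i : M_i → N)_{i∈ℕ} there exists a family (h_i : M_i → N)_{i∈ℕ} with g_i = h_i − u_i ≫ h_{i+1} for all i. Then the canonical map Ext¹(c, N) → lim_i Ext¹(M_i, N) is injective: any class E ∈ Ext¹(c, N) whose pullback along ι_i vanishes for every i is itself zero. -/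
open CategoryTheory CategoryTheory.Limits CategoryTheory.Abelian

universe w v u

open DerivedCategory Pretriangulated in
/-- Every class `E ∈ Ext¹(Z, N)` comes from maps `N ⟶ X ⟶ Z` with the expected
lifting properties (it is represented by a Yoneda extension). -/
theorem ext_one_exists_extension
    {C : Type u} [Category.{v} C] [Abelian C] [HasExt.{w} C]
    {Z N : C} (E : Ext Z N 1) :
    ∃ (X : C) (f : N ⟶ X) (p : X ⟶ Z), f ≫ p = 0 ∧
      (Ext.mk₀ p).comp E (zero_add 1) = 0 ∧
      (∀ {W : C} (a : W ⟶ Z), (Ext.mk₀ a).comp E (zero_add 1) = 0 →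
        ∃ s : W ⟶ X, s ≫ p = a) ∧
      (∀ {W : C} (b : W ⟶ X), b ≫ p = 0 → ∃ g : W ⟶ N, g ≫ f = b) := by
  let := HasDerivedCategory.standard C
  let F := singleFunctor C 0
  have key : ∀ {W : C} (a : W ⟶ Z), (Ext.mk₀ a).comp E (zero_add 1) = 0 ↔
      F.map a ≫ (show F.obj Z ⟶ (F.obj N)⟦(1 : ℤ)⟧ from E.hom) = 0 := by
    intro W a
    have h1 : ((Ext.mk₀ a).comp E (zero_add 1)).hom = F.map a ≫ E.hom := by
      rw [Ext.comp_hom, Ext.mk₀_hom]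
      exact ShiftedHom.mk₀_comp _ _ _ _
    constructor
    · intro h
      rw [h, Ext.zero_hom] at h1
      exact h1.symm
    · intro h
      apply Ext.ext
      rw [h1, Ext.zero_hom]
      exact h
  obtain ⟨Y, f₀, p₀, hT⟩ := distinguished_cocone_triangle₂
    (show F.obj Z ⟶ (F.obj N)⟦(1 : ℤ)⟧ from E.hom)
  have hLE : Y.IsLE 0 := TStructure.t.isLE₂ _ hT 0
    (inferInstanceAs (((singleFunctor C 0).obj N).IsLE 0))
    (inferInstanceAs (((singleFunctor C 0).obj Z).IsLE 0))
  have hGE : Y.IsGE 0 := TStructure.t.isGE₂ _ hT 0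
    (inferInstanceAs (((singleFunctor C 0).obj N).IsGE 0))
    (inferInstanceAs (((singleFunctor C 0).obj Z).IsGE 0))
  obtain ⟨X, ⟨e⟩⟩ := exists_iso_singleFunctor_obj_of_isGE_of_isLE Y 0
  obtain ⟨f, hf⟩ := F.map_surjective (f₀ ≫ e.hom)
  obtain ⟨p, hp⟩ := F.map_surjective (e.inv ≫ p₀)
  have h12 : f₀ ≫ p₀ = 0 := comp_distTriang_mor_zero₁₂ _ hT
  have h23 : p₀ ≫ (show F.obj Z ⟶ (F.obj N)⟦(1 : ℤ)⟧ from E.hom) = 0 :=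
    comp_distTriang_mor_zero₂₃ _ hT
  refine ⟨X, f, p, ?_, ?_, ?_, ?_⟩
  · apply F.map_injective
    rw [F.map_comp, hf, hp, Category.assoc, e.hom_inv_id_assoc, h12, F.map_zero]
  · rw [key, hp, Category.assoc, h23, comp_zero]
  · intro W a ha
    rw [key] at ha
    obtain ⟨g, hg⟩ : ∃ g : F.obj W ⟶ Y, F.map a = g ≫ p₀ :=
      Triangle.coyoneda_exact₃ _ hT (F.map a) ha
    obtain ⟨s, hs⟩ := F.map_surjective (g ≫ e.hom)
    refine ⟨s, F.map_injective ?_⟩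
    rw [F.map_comp, hs, hp, Category.assoc, e.hom_inv_id_assoc]
    exact hg.symm
  · intro W b hb
    have hb' : (F.map b ≫ e.inv) ≫ p₀ = 0 := by
      rw [Category.assoc, ← hp, ← F.map_comp, hb, F.map_zero]
    obtain ⟨g, hg⟩ : ∃ g : F.obj W ⟶ F.obj N, F.map b ≫ e.inv = g ≫ f₀ :=
      Triangle.coyoneda_exact₂ _ hT (F.map b ≫ e.inv) hb'
    obtain ⟨s, hs⟩ := F.map_surjective g
    refine ⟨s, F.map_injective ?_⟩
    have hg' : F.map b ≫ e.inv = g ≫ f₀ := hg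
    rw [F.map_comp, hs, hf, ← Category.assoc, ← hg', Category.assoc, e.inv_hom_id,
      Category.comp_id]

/-- Let `C` be an AB5 abelian category with Ext-groups, let `M : ℕ ⥤ C` be a sequential
direct system with colimit cocone `cc`, and let `N` be an object of `C`. Assume that
`lim¹` of the inverse system of abelian groups `(Hom(M i, N))` vanishes, concretely: for
every family of morphisms `(g i : M i ⟶ N)` there is a family `(h i : M i ⟶ N)` with
`g i = h i - u i ≫ h (i+1)` for all `i`, where `u i : M i ⟶ M (i+1)` are the transition
maps. Then the canonical map `Ext¹(cc.pt, N) → lim_i Ext¹(M i, N)` is injective: any class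
`E ∈ Ext¹(cc.pt, N)` whose pullback along `cc.ι.app i` vanishes for every `i` is zero. -/
theorem ext_one_injective_into_lim
    {C : Type u} [Category.{v} C] [Abelian C] [HasColimits C]
    [HasFilteredColimits C] [AB5 C] [HasExt.{w} C]
    (M : ℕ ⥤ C) (N : C) (cc : Cocone M) (hcc : IsColimit cc)
    (hlim1 : ∀ g : ∀ i : ℕ, (M.obj i ⟶ N), ∃ h : ∀ i : ℕ, (M.obj i ⟶ N),
      ∀ i : ℕ, g i = h i - M.map (homOfLE (Nat.le_succ i)) ≫ h (i + 1))
    (E : Ext cc.pt N 1)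
    (hE : ∀ i : ℕ, (Ext.mk₀ (cc.ι.app i)).comp E (zero_add 1) = 0) :
    E = 0 := by
  obtain ⟨X, f, p, hfp, hpE, hlift, hker⟩ := ext_one_exists_extension E
  choose s hs using fun i => hlift (cc.ι.app i) (hE i)
  have hw : ∀ i, M.map (homOfLE (Nat.le_succ i)) ≫ cc.ι.app (i + 1) = cc.ι.app i :=
    fun i => cc.w _
  choose g hg using fun i => hker (s i - M.map (homOfLE (Nat.le_succ i)) ≫ s (i + 1))
    (by rw [Preadditive.sub_comp, Category.assoc, hs, hs, hw, sub_self])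
  obtain ⟨h, hh⟩ := hlim1 g
  let t : ∀ i, M.obj i ⟶ X := fun i => s i - h i ≫ f
  have ht : ∀ i, M.map (homOfLE (Nat.le_succ i)) ≫ t (i + 1) = t i := by
    intro i
    have h1 := hg i
    rw [hh i, Preadditive.sub_comp, Category.assoc] at h1
    simp only [t, Preadditive.comp_sub]
    rw [sub_eq_sub_iff_add_eq_add] at h1 ⊢
    rw [add_comm, ← h1, add_comm]
  let ct : Cocone M :=
    { pt := X
      ι := NatTrans.ofSequence t (fun i => by
        simpa using ht i) }
  have hsec : hcc.desc ct ≫ p = 𝟙 cc.pt := by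
    apply hcc.hom_ext
    intro i
    rw [hcc.fac_assoc, Category.comp_id]
    change t i ≫ p = _
    simp only [t, Preadditive.sub_comp, Category.assoc, hfp, comp_zero, sub_zero, hs]
  rw [← Ext.mk₀_id_comp E, ← hsec, ← Ext.mk₀_comp_mk₀_assoc, hpE, Ext.comp_zero]
end

section
/- Let C be a pretriangulated category with countable coproducts which is compactly generated by a set G of compact objects. Let (x_{ij})_{i,j∈ℕ} be a commutative ℕ×ℕ-indexed diagram in C, with maps in both directions, horizontal maps x_{ij} → x_{i(j+1)} and vertical maps x_{ij} → x_{(i+1)j}, making all squares commute. For each i, let (f_{ij} : x_{ij} → z_i)_{j∈ℕ} be a minimal weak colimit cocone of the i-th row, and let χ_i : z_i → z_{i+1} be morphisms compatible with the cocones and the vertical maps of the diagram, i.e. χ_i ∘ f_{ij} equals the composite of the vertical map x_{ij} → x_{(i+1)j} with f_{(i+1)j} for all j. Let (g_i : x_{ii} → w)_{i∈ℕ} be a minimal weak colimit cocone of the diagonal sequence x_{00} → x_{11} → x_{22} → ⋯ (with maps given by composing one horizontal and one vertical map of the diagram), and let (k_i : z_i → v)_{i∈ℕ} be a minimal weak colimit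 cocone of the chain (z_i, χ_i). Then there exists an isomorphism θ : w ≅ v such that θ ∘ g_i = k_i ∘ f_{ii} for all i. -/
open CategoryTheory CategoryTheory.Limits CategoryTheory.Pretriangulated DirectSum

universe v u

namespace TTGStmt10

variable {C : Type u} [Category.{v} C] [Preadditive C] [HasCountableCoproducts C]

/-- An object `c` is compact if for every (countable) family `(f j)` of objects the
canonical map `⨁_j Hom(c, f j) → Hom(c, ∐_j f j)` is bijective. -/
def IsCompactObj (c : C) : Prop :=
  ∀ (J : Type v) [Countable J] [DecidableEq J] (f : J → C),
    Function.Bijective (DirectSum.toAddMonoid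
      (fun j : J => AddMonoidHom.mk' (fun φ : c ⟶ f j => φ ≫ Sigma.ι f j)
        (fun a b => Preadditive.add_comp _ _ _ a b _)) :
      (⨁ j : J, (c ⟶ f j)) →+ (c ⟶ ∐ f))

/-- `(app j : F.obj j ⟶ pt)` is a minimal weak colimit cocone of the sequential diagram
`F : ℕ ⥤ C`: it is a cocone, every other cocone factors (not necessarily uniquely)
through it, and for every compact object `c` the canonical map
`colim_j Hom(c, F.obj j) → Hom(c, pt)` is bijective (expressed elementwise). -/
structure IsMinimalWeakColimit (F : ℕ ⥤ C) (pt : C) (app : ∀ j : ℕ, F.obj j ⟶ pt) :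
    Prop where
  cocone : ∀ j : ℕ, F.map (homOfLE (Nat.le_succ j)) ≫ app (j + 1) = app j
  weak : ∀ (q : C) (c : ∀ j : ℕ, F.obj j ⟶ q),
    (∀ j : ℕ, F.map (homOfLE (Nat.le_succ j)) ≫ c (j + 1) = c j) →
      ∃ k : pt ⟶ q, ∀ j : ℕ, app j ≫ k = c j
  min_surj : ∀ c : C, IsCompactObj c → ∀ φ : c ⟶ pt,
    ∃ (j : ℕ) (ψ : c ⟶ F.obj j), ψ ≫ app j = φ
  min_inj : ∀ c : C, IsCompactObj c → ∀ (j j' : ℕ) (ψ : c ⟶ F.obj j) (ψ' : c ⟶ F.obj j'),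
    ψ ≫ app j = ψ' ≫ app j' →
      ∃ (l : ℕ) (h : j ≤ l) (h' : j' ≤ l),
        ψ ≫ F.map (homOfLE h) = ψ' ≫ F.map (homOfLE h')

/-- The `i`-th row `j ↦ X (i, j)` of an `ℕ×ℕ`-indexed diagram. -/
def rowFunctor (X : (ℕ × ℕ) ⥤ C) (i : ℕ) : ℕ ⥤ C :=
  (Functor.prod' ((Functor.const ℕ).obj i) (𝟭 ℕ)) ⋙ X

/-- The diagonal `i ↦ X (i, i)` of an `ℕ×ℕ`-indexed diagram. -/
def diagFunctor (X : (ℕ × ℕ) ⥤ C) : ℕ ⥤ C :=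
  Functor.diag ℕ ⋙ X

variable [HasZeroObject C] [HasShift C ℤ] [∀ n : ℤ, (shiftFunctor C n).Additive]
  [Pretriangulated C]

/-- Shifts of compact objects are compact. -/
theorem isCompactObj_shift {c : C} (hc : IsCompactObj c) (n : ℤ) :
    IsCompactObj (c⟦n⟧ : C) := by
  intro J _ _ f
  have hB := hc J (fun j => (f j)⟦-n⟧)
  let adj : shiftFunctor C n ⊣ shiftFunctor C (-n) := (shiftEquiv C n).toAdjunction
  let E : ∀ y : C, ((c⟦n⟧ : C) ⟶ y) ≃+ (c ⟶ (y⟦-n⟧ : C)) := fun y => adj.homAddEquiv c y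
  let P : (c ⟶ ∐ (fun j => (f j)⟦-n⟧)) →+ (c ⟶ ((∐ f)⟦-n⟧ : C)) :=
    AddMonoidHom.mk' (fun φ => φ ≫ sigmaComparison (shiftFunctor C (-n)) f)
      (fun a b => Preadditive.add_comp _ _ _ a b _)
  have hP : Function.Bijective P := by
    constructor
    · intro a b h
      exact (cancel_mono (sigmaComparison (shiftFunctor C (-n)) f)).1 h
    · intro a
      exact ⟨a ≫ inv (sigmaComparison (shiftFunctor C (-n)) f), by simp [P]⟩
  let Mp : (⨁ j : J, ((c⟦n⟧ : C) ⟶ f j)) ≃+ (⨁ j : J, (c ⟶ ((f j)⟦-n⟧ : C))) :=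
    DFinsupp.mapRange.addEquiv (fun j => E (f j))
  have key := hP.comp (hB.comp Mp.bijective)
  rw [← Function.Bijective.of_comp_iff' (E (∐ f)).bijective]
  convert key using 1
  rw [← AddMonoidHom.coe_coe (E (∐ f)), ← AddMonoidHom.coe_coe Mp, ← AddMonoidHom.coe_comp,
    ← AddMonoidHom.coe_comp, ← AddMonoidHom.coe_comp]
  congr 1
  apply DirectSum.addHom_ext
  intro j y
  have h1 : Mp (DirectSum.of (fun j : J => ((c⟦n⟧ : C) ⟶ f j)) j y) =
      DirectSum.of (fun j : J => (c ⟶ ((f j)⟦-n⟧ : C))) j (E (f j) y) :=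
    DFinsupp.mapRange_single (hf := fun j => map_zero (E (f j)))
  simp only [AddMonoidHom.comp_apply, AddMonoidHom.coe_coe, h1, DirectSum.toAddMonoid_of]
  simp [P, E, Adjunction.homEquiv_naturality_right]

/-- A morphism inducing bijections on maps from compact objects is an isomorphism. -/
theorem isIso_of_compact (G : Set C) (hGc : ∀ g ∈ G, IsCompactObj g)
    (hGgen : ∀ x : C, (∀ g ∈ G, ∀ (n : ℤ) (f : (g⟦n⟧ : C) ⟶ x), f = 0) → IsZero x)
    {w v : C} (θ : w ⟶ v)
    (hs : ∀ c : C, IsCompactObj c → ∀ φ : c ⟶ v, ∃ ψ : c ⟶ w, ψ ≫ θ = φ)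
    (hi : ∀ c : C, IsCompactObj c → ∀ ψ : c ⟶ w, ψ ≫ θ = 0 → ψ = 0) : IsIso θ := by
  obtain ⟨Z, a, b, hT⟩ := distinguished_cocone_triangle θ
  refine (Triangle.isZero₃_iff_isIso₁ _ hT).1 (hGgen _ fun g hg n f => ?_)
  have hc : IsCompactObj (g⟦n⟧ : C) := isCompactObj_shift (hGc g hg) n
  have hc' : IsCompactObj ((g⟦n⟧)⟦(-1 : ℤ)⟧ : C) := isCompactObj_shift hc (-1)
  let adj : shiftFunctor C (-1 : ℤ) ⊣ shiftFunctor C (1 : ℤ) :=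
    (shiftEquiv C (1 : ℤ)).symm.toAdjunction
  have hz : b ≫ θ⟦(1 : ℤ)⟧' = 0 := comp_distTriang_mor_zero₃₁ _ hT
  change (g⟦n⟧ : C) ⟶ Z at f
  have h0 : f ≫ b = 0 := by
    apply (adj.homAddEquiv _ _).symm.injective
    rw [map_zero]
    apply hi _ hc'
    change (adj.homEquiv _ _).symm (f ≫ b) ≫ θ = 0
    rw [← adj.homEquiv_naturality_right_symm, Category.assoc, hz, comp_zero]
    exact map_zero (adj.homAddEquiv _ _).symm
  obtain ⟨f', hf'⟩ := Triangle.coyoneda_exact₃ _ hT f h0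
  obtain ⟨ψ, rfl⟩ := hs _ hc f'
  have h1 : θ ≫ a = 0 := comp_distTriang_mor_zero₁₂ _ hT
  rw [hf']
  change (ψ ≫ θ) ≫ a = 0
  rw [Category.assoc, h1, comp_zero]

/-- Compatibility of a cocone over a sequence with all transition maps. -/
theorem cocone_of_le {F : ℕ ⥤ C} {q : C} (c : ∀ j : ℕ, F.obj j ⟶ q)
    (h : ∀ j : ℕ, F.map (homOfLE (Nat.le_succ j)) ≫ c (j + 1) = c j)
    {i j : ℕ} (hij : i ≤ j) : F.map (homOfLE hij) ≫ c j = c i := by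
  induction j, hij using Nat.le_induction with
  | base => 
    have : homOfLE (le_refl i) = 𝟙 i := rfl
    rw [this]; simp
  | succ j hij ih =>
    rw [← ih, ← h j, ← Category.assoc, ← F.map_comp]
    rfl

/-- In a pretriangulated category with countable coproducts which is compactly generated
by a set `G` of compact objects, the homotopy colimit (i.e. minimal weak colimit) of the
diagonal of a commutative `ℕ×ℕ`-indexed diagram `X` agrees, compatibly with the cocones,
with the iterated homotopy colimit obtained by first taking rowwise minimal weak colimits
`z i` with cocones `fm i`, and then the minimal weak colimit of the resulting chain
`(z i, χ i)`. -/
theorem diag_hocolim_iso_iterated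
    (G : Set C) (hGc : ∀ g ∈ G, IsCompactObj g)
    (hGgen : ∀ x : C, (∀ g ∈ G, ∀ (n : ℤ) (f : (g⟦n⟧ : C) ⟶ x), f = 0) → IsZero x)
    (X : (ℕ × ℕ) ⥤ C)
    (z : ℕ → C) (fm : ∀ i j : ℕ, X.obj (i, j) ⟶ z i)
    (hrow : ∀ i : ℕ, IsMinimalWeakColimit (rowFunctor X i) (z i) (fun j => fm i j))
    (χ : ∀ i : ℕ, z i ⟶ z (i + 1))
    (hχ : ∀ i j : ℕ, fm i j ≫ χ i =
      X.map ((homOfLE (Nat.le_succ i), 𝟙 j) : ((i, j) : ℕ × ℕ) ⟶ (i + 1, j)) ≫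
        fm (i + 1) j)
    (w : C) (g : ∀ i : ℕ, X.obj (i, i) ⟶ w)
    (hw : IsMinimalWeakColimit (diagFunctor X) w (fun i => g i))
    (v : C) (k : ∀ i : ℕ, z i ⟶ v)
    (hv : IsMinimalWeakColimit (Functor.ofSequence χ) v (fun i => k i)) :
    ∃ θ : w ≅ v, ∀ i : ℕ, g i ≫ θ.hom = fm i i ≫ k i := by
  -- transition maps of the bifunctor
  let t : ∀ {a b : ℕ × ℕ}, a ≤ b → (X.obj a ⟶ X.obj b) := fun h => X.map ((homOfLE h.1, homOfLE h.2) : _ ⟶ _)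
  let s : ∀ {i l : ℕ}, i ≤ l → (z i ⟶ z l) := fun h => (Functor.ofSequence χ).map (homOfLE h)
  have ht : ∀ {a b c : ℕ × ℕ} (h : a ≤ b) (h' : b ≤ c), t h ≫ t h' = t (h.trans h') := by
    intro a b c h h'
    exact (X.map_comp _ _).symm
  -- compatibility along rows
  have hr : ∀ {i j j' : ℕ} (h : ((i, j) : ℕ × ℕ) ≤ (i, j')), t h ≫ fm i j' = fm i j := by
    intro i j j' h
    exact cocone_of_le (F := rowFunctor X i) (fun j => fm i j) (hrow i).cocone h.2
  -- compatibility along columns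
  have hcol : ∀ {i l : ℕ} (j : ℕ) (h : i ≤ l) (h' : ((i, j) : ℕ × ℕ) ≤ (l, j)),
      fm i j ≫ s h = t h' ≫ fm l j := by
    intro i l j h
    induction l, h using Nat.le_induction with
    | base =>
      intro h'
      have e1 : s (le_refl i) = 𝟙 _ :=
        (Functor.ofSequence χ).map_id i
      have e2 : t h' = 𝟙 _ := X.map_id (i, j)
      rw [e1, e2]
      exact (Category.comp_id _).trans (Category.id_comp _).symm
    | succ l hl ih =>
      intro h'
      have h1 : ((i, j) : ℕ × ℕ) ≤ (l, j) := ⟨hl, le_rfl⟩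
      have h2 : ((l, j) : ℕ × ℕ) ≤ (l + 1, j) := ⟨Nat.le_succ l, le_rfl⟩
      have e1 : s (hl.trans (Nat.le_succ l)) =
          s hl ≫ χ l := by
        have e0 : s (Nat.le_succ l) = χ l := Functor.ofSequence_map_homOfLE_succ χ l
        rw [← e0]
        exact (Functor.ofSequence χ).map_comp (homOfLE hl) (homOfLE (Nat.le_succ l))
      have e3 : fm l j ≫ χ l = t h2 ≫ fm (l + 1) j := hχ l j
      calc _ = fm i j ≫ s hl ≫ χ l := by
            exact congrArg (fun q => fm i j ≫ q) e1
        _ = (fm i j ≫ s hl) ≫ χ l :=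
            (Category.assoc _ _ _).symm
        _ = (t h1 ≫ fm l j) ≫ χ l := congrArg (fun q => q ≫ χ l) (ih h1)
        _ = t h1 ≫ t h2 ≫ fm (l + 1) j := by rw [Category.assoc, e3]
        _ = t h' ≫ fm (l + 1) j := by rw [← Category.assoc, ht h1 h2]
  have hk : ∀ {i l : ℕ} (h : i ≤ l), s h ≫ k l = k i :=
    fun h => cocone_of_le (F := Functor.ofSequence χ) (fun i => k i) hv.cocone h
  -- the total cocone `X (i, j) ⟶ v`
  have htot : ∀ {i j i' j' : ℕ} (h : ((i, j) : ℕ × ℕ) ≤ (i', j')),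
      t h ≫ fm i' j' ≫ k i' = fm i j ≫ k i := by
    intro i j i' j' h
    have h1 : ((i, j) : ℕ × ℕ) ≤ (i', j) := ⟨h.1, le_rfl⟩
    have h2 : ((i', j) : ℕ × ℕ) ≤ (i', j') := ⟨le_rfl, h.2⟩
    rw [← ht h1 h2, Category.assoc, ← Category.assoc (t h2), hr h2, ← Category.assoc,
      ← hcol j h.1 h1, ← hk h.1]
    exact Category.assoc _ _ _
  have hg : ∀ {i l : ℕ} (h : ((i, i) : ℕ × ℕ) ≤ (l, l)), t h ≫ g l = g i :=
    fun h => cocone_of_le (F := diagFunctor X) (fun i => g i) hw.cocone h.1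
  obtain ⟨θ, hθ⟩ := hw.weak v (fun i => fm i i ≫ k i)
    (fun i => htot (i := i) (j := i) ⟨Nat.le_succ i, Nat.le_succ i⟩)
  replace hθ : ∀ i, g i ≫ θ = fm i i ≫ k i := hθ
  have hiso : IsIso θ := by
    apply isIso_of_compact G hGc hGgen θ
    · intro c hc φ
      obtain ⟨i, ψ, hψ⟩ := hv.min_surj c hc φ
      change c ⟶ z i at ψ
      obtain ⟨j, ρ, hρ⟩ := (hrow i).min_surj c hc ψ
      change c ⟶ X.obj (i, j) at ρ
      replace hψ : ψ ≫ k i = φ := hψ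
      replace hρ : ρ ≫ fm i j = ψ := hρ
      have h : ((i, j) : ℕ × ℕ) ≤ (max i j, max i j) := ⟨le_max_left _ _, le_max_right _ _⟩
      refine ⟨ρ ≫ t h ≫ g (max i j), ?_⟩
      rw [Category.assoc, Category.assoc, hθ, htot h, ← hψ, ← hρ, Category.assoc]
    · intro c hc α hα
      obtain ⟨i, ψ, hψ⟩ := hw.min_surj c hc α
      change c ⟶ X.obj (i, i) at ψ
      replace hψ : ψ ≫ g i = α := hψ
      have h0 : (ψ ≫ fm i i) ≫ k i = (0 : c ⟶ z i) ≫ k i := by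
        rw [Category.assoc, ← hθ, ← Category.assoc, hψ, hα, zero_comp]
      obtain ⟨l, hl, hl', e⟩ := hv.min_inj c hc i i (ψ ≫ fm i i) 0 h0
      have h1 : ((i, i) : ℕ × ℕ) ≤ (l, i) := ⟨hl, le_rfl⟩
      have e' : (ψ ≫ t h1) ≫ fm l i = (0 : c ⟶ X.obj (l, i)) ≫ fm l i := by
        rw [Category.assoc, ← hcol i hl h1, zero_comp, ← Category.assoc]
        exact e.trans zero_comp
      obtain ⟨m, hm, hm', e2⟩ := (hrow l).min_inj c hc i i (ψ ≫ t h1) 0 e'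
      have h2 : ((l, i) : ℕ × ℕ) ≤ (l, m) := ⟨le_rfl, hm⟩
      have e3 : (ψ ≫ t h1) ≫ t h2 = 0 := e2.trans zero_comp
      have h3 : ((l, m) : ℕ × ℕ) ≤ (max l m, max l m) := ⟨le_max_left _ _, le_max_right _ _⟩
      have h4 : ((i, i) : ℕ × ℕ) ≤ (max l m, max l m) := h1.trans (h2.trans h3)
      rw [← hψ, ← hg h4, ← ht h1 (h2.trans h3), ← ht h2 h3]
      rw [Category.assoc] at e3
      rw [← Category.assoc, ← Category.assoc (t h1), ← Category.assoc ψ, e3, zero_comp, zero_comp]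
  exact ⟨asIso θ, hθ⟩

end TTGStmt10
end
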